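/- arXiv:math/9605214 — 3 statements merged into one kernel-verified Lean document; each statement's English description precedes it below -/
import Mathlib

section
/- Let 1 < p, q < ∞ with p ≠ q, and let x¹, x² ∈ ℓ_p(ℓ_q) with ‖x¹‖ = ‖x²‖ = 1 be disjointly supported in the scalar sense (supp x¹ ∩ supp x² = ∅). Then F = span{x¹, x²} is 1-complemented in ℓ_p(ℓ_q) if and only if one of the following holds: (a) v-supp x¹ ∩ v-supp x² = ∅, and in this case F is isometric to ℓ_p²; or (b) v-supp x¹ = v-supp x² and ‖x¹_i‖_q = ‖x²_i‖_q for all i ∈ v-supp x¹, and in this case F is isometric to ℓ_q². -/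
noncomputable section
open scoped ENNReal ComplexConjugate

/-- The space `ℓ_p(ℓ_q)` over the scalars `𝕜`, with outer index `ι` and inner index `κ`. -/
abbrev Lplq (𝕜 : Type*) [RCLike 𝕜] (ι κ : Type*) (p q : ℝ≥0∞)
    [Fact (1 ≤ p)] [Fact (1 ≤ q)] : Type _ :=
  lp (fun _ : ι => lp (fun _ : κ => 𝕜) q) p

namespace Lplq

variable {𝕜 : Type*} [RCLike 𝕜] {ι κ : Type*} {p q : ℝ≥0∞} [Fact (1 ≤ p)] [Fact (1 ≤ q)]

/-- The scalar support of `x ∈ ℓ_p(ℓ_q)`: the set of pairs `(i, j)` with `x i j ≠ 0`. -/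
def ssupp (x : Lplq 𝕜 ι κ p q) : Set (ι × κ) := {ij | x ij.1 ij.2 ≠ 0}

/-- The vector support of `x ∈ ℓ_p(ℓ_q)`: the set of `i` with `x i ≠ 0` in `ℓ_q`. -/
def vsupp (x : Lplq 𝕜 ι κ p q) : Set ι := {i | x i ≠ 0}

end Lplq

/-- `Y` is 1-complemented: it is the range of a projection of norm one. -/
def IsOneComplemented {𝕜 X : Type*} [RCLike 𝕜] [NormedAddCommGroup X] [NormedSpace 𝕜 X]
    (Y : Submodule 𝕜 X) : Prop :=
  ∃ P : X →L[𝕜] X, (∀ x, P (P x) = P x) ∧ ‖P‖ = 1 ∧ LinearMap.range P.toLinearMap = Y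

namespace lp

variable {α : Type*} {E : α → Type*} [∀ i, NormedAddCommGroup (E i)] {p : ℝ≥0∞}

lemma norm_add_rpow_of_disjoint (hp : 0 < p.toReal) (u v : lp E p)
    (h : ∀ i, u i = 0 ∨ v i = 0) :
    ‖u + v‖ ^ p.toReal = ‖u‖ ^ p.toReal + ‖v‖ ^ p.toReal := by
  refine (hasSum_norm hp (u + v)).unique ?_
  convert (hasSum_norm hp u).add (hasSum_norm hp v) using 2 with i
  rcases h i with h | h <;> simp [h, Real.zero_rpow hp.ne']

lemma norm_add_single_rpow [DecidableEq α] (hp : 0 < p.toReal) (u : lp E p) (i : α) (v : E i) :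
    ‖u + lp.single p i v‖ ^ p.toReal =
      ‖u‖ ^ p.toReal - ‖u i‖ ^ p.toReal + ‖u i + v‖ ^ p.toReal := by
  have hp0 : 0 < p := (ENNReal.toReal_pos_iff.1 hp).1
  have h₁ : u + lp.single p i v = (u - lp.single p i (u i)) + lp.single p i (u i + v) := by
    rw [lp.single_add]; abel
  rw [h₁, norm_add_rpow_of_disjoint hp, lp.norm_single hp0]
  · have := lp.norm_compl_sum_single hp u {i}
    simp only [Finset.sum_singleton] at this
    rw [this]
  · intro j
    by_cases hj : j = i
    · subst hj; left; simp
    · right; simp [hj]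

variable {𝕜 : Type*} [RCLike 𝕜] [∀ i, NormedSpace 𝕜 (E i)] [Fact (1 ≤ p)]

lemma norm_smul_add_smul_rpow_of_disjoint (hp : 0 < p.toReal) (u v : lp E p)
    (h : ∀ i, u i = 0 ∨ v i = 0) (a b : 𝕜) :
    ‖a • u + b • v‖ ^ p.toReal =
      ‖a‖ ^ p.toReal * ‖u‖ ^ p.toReal + ‖b‖ ^ p.toReal * ‖v‖ ^ p.toReal := by
  rw [norm_add_rpow_of_disjoint hp, norm_smul, norm_smul, Real.mul_rpow (norm_nonneg _)
    (norm_nonneg _), Real.mul_rpow (norm_nonneg _) (norm_nonneg _)]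
  intro i
  exact (h i).imp (fun h => by simp [h]) (fun h => by simp [h])

open Classical in
/-- The band projection of `lp E p` onto the elements supported in `s`. -/
def restrict (𝕜 : Type*) [RCLike 𝕜] [∀ i, NormedSpace 𝕜 (E i)] (s : Set α) :
    lp E p →L[𝕜] lp E p :=
  mapCLM p (fun i => if i ∈ s then ContinuousLinearMap.id 𝕜 (E i) else 0) (K := 1) zero_le_one
    (fun i => by split_ifs <;> simp [ContinuousLinearMap.norm_id_le])

open Classical in
lemma restrict_apply (s : Set α) (z : lp E p) (i : α) :
    restrict 𝕜 s z i = if i ∈ s then z i else 0 := by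
  change (if i ∈ s then ContinuousLinearMap.id 𝕜 (E i) else 0) (z i) = _
  split_ifs <;> simp

/-- Two disjointly supported vectors of `lp E p` have norming functionals that are jointly
contractive into the two-dimensional `ℓ_p` space. -/
lemma exists_pair_dual_of_disjoint (𝕜 : Type*) [RCLike 𝕜] [∀ i, NormedSpace 𝕜 (E i)]
    (hp : 0 < p.toReal) (u v : lp E p) (h : ∀ i, u i = 0 ∨ v i = 0) :
    ∃ S : lp E p →L[𝕜] PiLp p (fun _ : Fin 2 => 𝕜), (∀ z, ‖S z‖ ≤ ‖z‖) ∧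
      S u = WithLp.toLp p ![(‖u‖ : 𝕜), 0] ∧ S v = WithLp.toLp p ![0, (‖v‖ : 𝕜)] := by
  obtain ⟨f, hf, hfu⟩ := exists_dual_vector'' 𝕜 u
  obtain ⟨g, hg, hgv⟩ := exists_dual_vector'' 𝕜 v
  set s : Set α := {i | u i ≠ 0}
  have hu : restrict 𝕜 s u = u := by
    ext i; rw [restrict_apply]; split_ifs with hi <;> simp_all [s]
  have hu' : restrict 𝕜 sᶜ u = 0 := by
    ext i; rw [restrict_apply]; split_ifs with hi <;> simp_all [s]
  have hv : restrict 𝕜 s v = 0 := by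
    ext i; rw [restrict_apply]; rcases h i with h | h <;> simp [s, h]
  have hv' : restrict 𝕜 sᶜ v = v := by
    ext i; rw [restrict_apply]; rcases h i with h | h <;> simp [s, h]
  have hz (z : lp E p) : z = restrict 𝕜 s z + restrict 𝕜 sᶜ z := by
    ext i
    rw [lp.coeFn_add, Pi.add_apply, restrict_apply, restrict_apply]
    by_cases hi : i ∈ s <;> simp [hi]
  refine ⟨(PiLp.continuousLinearEquiv p 𝕜 (fun _ : Fin 2 => 𝕜)).symm.toContinuousLinearMap ∘L
    ContinuousLinearMap.pi ![f ∘L restrict 𝕜 s, g ∘L restrict 𝕜 sᶜ], fun z => ?_, ?_, ?_⟩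
  · rw [← Real.rpow_le_rpow_iff (norm_nonneg _) (norm_nonneg _) hp, PiLp.norm_eq_sum hp,
      one_div, Real.rpow_inv_rpow (by positivity) hp.ne', Fin.sum_univ_two]
    conv_rhs => rw [hz z]
    rw [norm_add_rpow_of_disjoint hp]
    · refine add_le_add (Real.rpow_le_rpow (norm_nonneg _) ?_ hp.le)
        (Real.rpow_le_rpow (norm_nonneg _) ?_ hp.le)
      · simpa using f.le_of_opNorm_le hf (restrict 𝕜 s z)
      · simpa using g.le_of_opNorm_le hg (restrict 𝕜 sᶜ z)
    · intro i
      rw [restrict_apply, restrict_apply]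
      by_cases hi : i ∈ s <;> simp [hi]
  · ext i
    fin_cases i <;> simp [hu, hu', hfu]
  · ext i
    fin_cases i <;> simp [hv, hv', hgv]

/-- Contractions on the coordinates of `lp E p`, averaged against a norm-one element, give a
contraction on `lp E p`. -/
lemma exists_average {F : Type*} [NormedAddCommGroup F] [NormedSpace 𝕜 F] [CompleteSpace F]
    (hp : 1 < p.toReal) (u : lp E p) (hu : ‖u‖ = 1) (S : ∀ i, E i →L[𝕜] F)
    (hS : ∀ i z, ‖S i z‖ ≤ ‖z‖) :
    ∃ G : lp E p →L[𝕜] F, (∀ z, ‖G z‖ ≤ ‖z‖) ∧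
      ∀ z e, (∀ i, S i (z i) = (‖u i‖ : 𝕜) • e) → G z = e := by
  have hp0 : 0 < p.toReal := zero_lt_one.trans hp
  set r := p.toReal with hr
  have hc : (r / (r - 1)).HolderConjugate r := (Real.HolderConjugate.conjExponent hp).symm
  have hpow (i : α) : (‖u i‖ ^ (r - 1)) ^ (r / (r - 1)) = ‖u i‖ ^ r := by
    rw [← Real.rpow_mul (norm_nonneg _), mul_div_cancel₀ _ (by linarith)]
  have hus : HasSum (fun i => ‖u i‖ ^ r) 1 := by
    simpa [hu] using hasSum_norm hp0 u
  have hw (i : α) : 0 ≤ ‖u i‖ ^ (r - 1) := Real.rpow_nonneg (norm_nonneg _) _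
  have hbound (z : lp E p) (i : α) :
      ‖((‖u i‖ ^ (r - 1) : ℝ) : 𝕜) • S i (z i)‖ ≤ ‖u i‖ ^ (r - 1) * ‖z i‖ := by
    rw [norm_smul, RCLike.norm_ofReal, abs_of_nonneg (hw i)]
    exact mul_le_mul_of_nonneg_left (hS i _) (hw i)
  have hsum' (z : lp E p) : Summable fun i => ‖u i‖ ^ (r - 1) * ‖z i‖ :=
    Real.summable_mul_of_Lp_Lq_of_nonneg hc hw (fun i => norm_nonneg _)
      (by simpa only [hpow] using hus.summable) (hasSum_norm hp0 z).summable
  have hsum (z : lp E p) : Summable fun i => ((‖u i‖ ^ (r - 1) : ℝ) : 𝕜) • S i (z i) :=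
    .of_norm_bounded (hsum' z) (hbound z)
  have hle (z : lp E p) : ‖∑' i, ((‖u i‖ ^ (r - 1) : ℝ) : 𝕜) • S i (z i)‖ ≤ ‖z‖ := by
    refine (tsum_of_norm_bounded (hsum' z).hasSum (hbound z)).trans ?_
    refine (Real.inner_le_Lp_mul_Lq_tsum_of_nonneg hc hw (fun i => norm_nonneg _)
      (by simpa only [hpow] using hus.summable) (hasSum_norm hp0 z).summable).trans_eq ?_
    have hzs : HasSum (fun i => ‖z i‖ ^ r) (‖z‖ ^ r) := hasSum_norm hp0 z
    simp only [hpow, hus.tsum_eq, hzs.tsum_eq, Real.one_rpow, one_mul, one_div]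
    exact Real.rpow_rpow_inv (norm_nonneg _) hp0.ne'
  refine ⟨LinearMap.mkContinuous
    ⟨⟨fun z => ∑' i, ((‖u i‖ ^ (r - 1) : ℝ) : 𝕜) • S i (z i), fun z w => ?_⟩, fun a z => ?_⟩ 1
    (fun z => by simpa using hle z), fun z => hle z, fun z e hze => ?_⟩
  · rw [← (hsum z).tsum_add (hsum w)]
    simp
  · rw [RingHom.id_apply, ← (hsum z).tsum_const_smul]
    simp [smul_comm a]
  · change ∑' i, ((‖u i‖ ^ (r - 1) : ℝ) : 𝕜) • S i (z i) = e
    have h1 (i : α) : ((‖u i‖ ^ (r - 1) : ℝ) : 𝕜) • S i (z i) = ((‖u i‖ ^ r : ℝ) : 𝕜) • e := by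
      rw [hze, smul_smul, ← RCLike.ofReal_mul]
      rcases (norm_nonneg (u i)).eq_or_lt with h0 | h0
      · rw [← h0, mul_zero, Real.zero_rpow hp0.ne']
      · rw [← Real.rpow_add_one h0.ne', sub_add_cancel]
    simp only [h1]
    have := ((RCLike.hasSum_ofReal 𝕜).2 hus).smul_const e
    simpa using this.tsum_eq

end lp

section Span

variable {𝕜 X : Type*} [RCLike 𝕜] [NormedAddCommGroup X] [NormedSpace 𝕜 X]

/-- Vectors behaving like the unit vectors of `ℓ_r²` give an isometric embedding of `ℓ_r²`. -/
lemma exists_linearIsometry_pair {r : ℝ≥0∞} [Fact (1 ≤ r)] (hr : 0 < r.toReal) (x y : X)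
    (h : ∀ a b : 𝕜, ‖a • x + b • y‖ ^ r.toReal = ‖a‖ ^ r.toReal + ‖b‖ ^ r.toReal) :
    ∃ T : PiLp r (fun _ : Fin 2 => 𝕜) →ₗᵢ[𝕜] X, (∀ c, T c = c 0 • x + c 1 • y) ∧
      LinearMap.range T.toLinearMap = Submodule.span 𝕜 {x, y} := by
  refine ⟨⟨⟨⟨fun c => c 0 • x + c 1 • y, fun c d => ?_⟩, fun a c => ?_⟩, fun c => ?_⟩,
    fun c => rfl, ?_⟩
  · simp only [PiLp.add_apply, add_smul]; abel
  · simp [mul_smul]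
  · change ‖c 0 • x + c 1 • y‖ = ‖c‖
    rw [PiLp.norm_eq_sum hr, Fin.sum_univ_two, ← h, one_div,
      Real.rpow_rpow_inv (norm_nonneg _) hr.ne']
  · ext z
    rw [Submodule.mem_span_pair]
    constructor
    · rintro ⟨c, rfl⟩
      exact ⟨c 0, c 1, rfl⟩
    · rintro ⟨a, b, rfl⟩
      exact ⟨WithLp.toLp r ![a, b], by simp⟩

lemma isOneComplemented_range {E : Type*} [NormedAddCommGroup E] [NormedSpace 𝕜 E] [Nontrivial E]
    (T : E →ₗᵢ[𝕜] X) (G : X →L[𝕜] E) (hG : ∀ z, ‖G z‖ ≤ ‖z‖) (hGT : ∀ c, G (T c) = c) :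
    IsOneComplemented (LinearMap.range T.toLinearMap) := by
  refine ⟨T.toContinuousLinearMap ∘L G, fun x => by simp [hGT], le_antisymm ?_ ?_, ?_⟩
  · exact ContinuousLinearMap.opNorm_le_bound _ zero_le_one fun z => by simpa using hG z
  · obtain ⟨c, hc⟩ := exists_ne (0 : E)
    have := (T.toContinuousLinearMap ∘L G).le_opNorm (T c)
    simp only [ContinuousLinearMap.comp_apply, LinearIsometry.coe_toContinuousLinearMap, hGT,
      LinearIsometry.norm_map] at this
    exact le_of_mul_le_mul_right (by simpa using this) (norm_pos_iff.2 hc)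
  · ext z
    constructor
    · rintro ⟨w, rfl⟩
      exact ⟨G w, rfl⟩
    · rintro ⟨c, rfl⟩
      exact ⟨T c, by simp [hGT]⟩

end Span

section Real

lemma hasDerivAt_abs_one_add_mul_rpow {s : ℝ} (hs : 1 < s) (c : ℝ) :
    HasDerivAt (fun h : ℝ => |1 + h * c| ^ s) (s * c) 0 := by
  have h₁ : HasDerivAt (fun h : ℝ => 1 + h * c) c 0 := by
    simpa using ((hasDerivAt_id (0 : ℝ)).mul_const c).const_add 1
  have h₂ := hasDerivAt_abs_rpow (1 + 0 * c) hs
  simpa [Function.comp_def] using h₂.comp (0 : ℝ) h₁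

lemma hasDerivAt_abs_rpow_mul_add_rpow {s r A B : ℝ} (hs : 1 < s) (hr : 1 < r) (hA : 0 ≤ A)
    (hB : 0 ≤ B) : HasDerivAt (fun h : ℝ => (|h| ^ s * A + B) ^ (r / s)) 0 0 := by
  have hs0 : 0 < s := zero_lt_one.trans hs
  rcases hB.eq_or_lt with rfl | hB
  · have h₁ : (fun h : ℝ => (|h| ^ s * A + 0) ^ (r / s)) = fun h => |h| ^ r * A ^ (r / s) := by
      ext h
      rw [add_zero, Real.mul_rpow (by positivity) hA, ← Real.rpow_mul (abs_nonneg h),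
        mul_div_cancel₀ _ hs0.ne']
    rw [h₁]
    simpa using (hasDerivAt_abs_rpow 0 hr).mul_const (A ^ (r / s))
  · have h₁ : HasDerivAt (fun h : ℝ => |h| ^ s * A + B) 0 0 := by
      simpa using ((hasDerivAt_abs_rpow 0 hs).mul_const A).add_const B
    simpa using h₁.rpow_const (p := r / s) (Or.inl (by simp [Real.zero_rpow hs0.ne', hB.ne']))

lemma hasDerivAt_abs_one_add_mul_rpow_mul_add_rpow {s A B : ℝ} (hs : 1 < s) (t c : ℝ) (hA : 0 < A)
    (hB : 0 ≤ B) :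
    HasDerivAt (fun h : ℝ => (|1 + h * c| ^ s * A + B) ^ t)
      (s * c * A * t * (A + B) ^ (t - 1)) 0 := by
  have h₁ := ((hasDerivAt_abs_one_add_mul_rpow hs c).mul_const A).add_const B
  have h₂ := h₁.rpow_const (p := t) (Or.inl (by simp; positivity))
  simpa using h₂

lemma rpow_ratio_injective {s r a b c d : ℝ} (hs : 0 < s) (hsr : r ≠ s)
    (ha : 0 < a) (hb : 0 ≤ b) (hc : 0 < c) (hd : 0 ≤ d)
    (h : (a ^ r)⁻¹ * a ^ s * (a ^ s + b ^ s) ^ (r / s - 1) =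
      (c ^ r)⁻¹ * c ^ s * (c ^ s + d ^ s) ^ (r / s - 1)) :
    b * c = d * a := by
  have hform {x y : ℝ} (hx : 0 < x) (hy : 0 ≤ y) :
      (x ^ r)⁻¹ * x ^ s * (x ^ s + y ^ s) ^ (r / s - 1) = (1 + (y / x) ^ s) ^ (r / s - 1) := by
    have h₁ : x ^ s + y ^ s = x ^ s * (1 + (y / x) ^ s) := by
      rw [Real.div_rpow hy hx.le, mul_add, mul_one, mul_div_cancel₀ _ (by positivity)]
    rw [h₁, Real.mul_rpow (by positivity) (by positivity), ← Real.rpow_mul hx.le,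
      show s * (r / s - 1) = r - s by field_simp, Real.rpow_sub hx]
    have := (Real.rpow_pos_of_pos hx r).ne'
    have := (Real.rpow_pos_of_pos hx s).ne'
    field_simp
  rw [hform ha hb, hform hc hd, Real.rpow_left_inj (by positivity) (by positivity)
    (sub_ne_zero.2 fun h => hsr ((div_eq_one_iff_eq hs.ne').1 h)), add_right_inj,
    Real.rpow_left_inj (by positivity) (by positivity) hs.ne', div_eq_div_iff ha.ne' hc.ne'] at h
  exact h

end Real

namespace Lplq

variable {𝕜 : Type*} [RCLike 𝕜] {ι κ : Type*} {p q : ℝ≥0∞} [Fact (1 ≤ p)] [Fact (1 ≤ q)]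

lemma disjoint_apply {x₁ x₂ : Lplq 𝕜 ι κ p q} (hdisj : ssupp x₁ ∩ ssupp x₂ = ∅) (i : ι) (j : κ) :
    x₁ i j = 0 ∨ x₂ i j = 0 := by
  by_contra! h
  have : (i, j) ∈ ssupp x₁ ∩ ssupp x₂ := h
  simp [hdisj] at this

lemma disjoint_apply_of_vsupp {x₁ x₂ : Lplq 𝕜 ι κ p q} (h : vsupp x₁ ∩ vsupp x₂ = ∅) (i : ι) :
    x₁ i = 0 ∨ x₂ i = 0 := by
  by_contra! h'
  have : i ∈ vsupp x₁ ∩ vsupp x₂ := h'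
  simp [h] at this

lemma norm_apply_eq {x₁ x₂ : Lplq 𝕜 ι κ p q}
    (h : vsupp x₁ = vsupp x₂ ∧ ∀ i ∈ vsupp x₁, ‖x₁ i‖ = ‖x₂ i‖) (i : ι) :
    ‖x₂ i‖ = ‖x₁ i‖ := by
  by_cases hi : i ∈ vsupp x₁
  · exact (h.2 i hi).symm
  · have hi' := hi
    rw [h.1] at hi'
    simp only [vsupp, Set.mem_ofPred_eq, not_not] at hi hi'
    rw [hi, hi']

/-- Pairs with disjoint vector supports span an isometric copy of `ℓ_p²`. -/
lemma norm_rpow_of_vsupp_disjoint (hp : 0 < p.toReal) {x₁ x₂ : Lplq 𝕜 ι κ p q}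
    (hx₁ : ‖x₁‖ = 1) (hx₂ : ‖x₂‖ = 1) (h : vsupp x₁ ∩ vsupp x₂ = ∅) (a b : 𝕜) :
    ‖a • x₁ + b • x₂‖ ^ p.toReal = ‖a‖ ^ p.toReal + ‖b‖ ^ p.toReal := by
  simp [lp.norm_smul_add_smul_rpow_of_disjoint hp _ _ (disjoint_apply_of_vsupp h), hx₁, hx₂]

/-- Pairs with disjoint scalar supports and equal block norms span an isometric copy of `ℓ_q²`. -/
lemma norm_rpow_of_norm_apply_eq (hp : 0 < p.toReal) (hq : 0 < q.toReal) {x₁ x₂ : Lplq 𝕜 ι κ p q}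
    (hx₁ : ‖x₁‖ = 1) (hdisj : ssupp x₁ ∩ ssupp x₂ = ∅) (h : ∀ i, ‖x₂ i‖ = ‖x₁ i‖) (a b : 𝕜) :
    ‖a • x₁ + b • x₂‖ ^ q.toReal = ‖a‖ ^ q.toReal + ‖b‖ ^ q.toReal := by
  have hab : 0 ≤ ‖a‖ ^ q.toReal + ‖b‖ ^ q.toReal := by positivity
  set c : ℝ := (‖a‖ ^ q.toReal + ‖b‖ ^ q.toReal) ^ (q.toReal)⁻¹ with hc
  have hc0 : 0 ≤ c := by positivity
  have hcq : c ^ q.toReal = ‖a‖ ^ q.toReal + ‖b‖ ^ q.toReal := Real.rpow_inv_rpow hab hq.ne'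
  have hp0 : p ≠ 0 := (ENNReal.toReal_pos_iff.1 hp).1.ne'
  have hblock (i : ι) : ‖(a • x₁ + b • x₂) i‖ = ‖((c : 𝕜) • x₁) i‖ := by
    rw [← Real.rpow_left_inj (norm_nonneg _) (norm_nonneg _) hq.ne']
    simp only [lp.coeFn_add, lp.coeFn_smul, Pi.add_apply, Pi.smul_apply]
    rw [lp.norm_smul_add_smul_rpow_of_disjoint hq _ _ (disjoint_apply hdisj i), h i, norm_smul,
      Real.mul_rpow (norm_nonneg _) (norm_nonneg _), RCLike.norm_ofReal, abs_of_nonneg hc0, hcq]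
    ring
  have : ‖a • x₁ + b • x₂‖ = ‖(c : 𝕜) • x₁‖ :=
    le_antisymm (lp.norm_mono hp0 fun i => (hblock i).le) (lp.norm_mono hp0 fun i => (hblock i).ge)
  rw [this, norm_smul, hx₁, RCLike.norm_ofReal, abs_of_nonneg hc0, mul_one, hcq]

lemma isOneComplemented_of_vsupp_disjoint (hp : 0 < p.toReal) {x₁ x₂ : Lplq 𝕜 ι κ p q}
    (hx₁ : ‖x₁‖ = 1) (hx₂ : ‖x₂‖ = 1) (h : vsupp x₁ ∩ vsupp x₂ = ∅) :
    IsOneComplemented (Submodule.span 𝕜 {x₁, x₂}) := by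
  obtain ⟨T, hT, hTr⟩ := exists_linearIsometry_pair hp x₁ x₂
    (norm_rpow_of_vsupp_disjoint (𝕜 := 𝕜) hp hx₁ hx₂ h)
  obtain ⟨S, hS, hS₁, hS₂⟩ := lp.exists_pair_dual_of_disjoint 𝕜 hp x₁ x₂ (disjoint_apply_of_vsupp h)
  rw [← hTr]
  refine isOneComplemented_range T S hS fun c => ?_
  rw [hT, map_add, map_smul, map_smul, hS₁, hS₂]
  ext i
  fin_cases i <;> simp [hx₁, hx₂]

lemma isOneComplemented_of_norm_apply_eq (hp : 1 < p.toReal) (hq : 0 < q.toReal)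
    {x₁ x₂ : Lplq 𝕜 ι κ p q} (hx₁ : ‖x₁‖ = 1) (hdisj : ssupp x₁ ∩ ssupp x₂ = ∅)
    (h : ∀ i, ‖x₂ i‖ = ‖x₁ i‖) :
    IsOneComplemented (Submodule.span 𝕜 {x₁, x₂}) := by
  obtain ⟨T, hT, hTr⟩ := exists_linearIsometry_pair hq x₁ x₂
    (norm_rpow_of_norm_apply_eq (𝕜 := 𝕜) (zero_lt_one.trans hp) hq hx₁ hdisj h)
  choose S hS hS₁ hS₂ using fun i =>
    lp.exists_pair_dual_of_disjoint 𝕜 hq (x₁ i) (x₂ i) (disjoint_apply hdisj i)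
  obtain ⟨G, hG, hG'⟩ := lp.exists_average hp x₁ hx₁ S hS
  rw [← hTr]
  refine isOneComplemented_range T G hG fun c => ?_
  rw [hT, map_add, map_smul, map_smul, hG' x₁ (WithLp.toLp q ![1, 0]) fun i => ?_,
    hG' x₂ (WithLp.toLp q ![0, 1]) fun i => ?_]
  · ext i
    fin_cases i <;> simp
  · rw [hS₂, h]
    ext i
    fin_cases i <;> simp [RCLike.real_smul_eq_coe_mul]
  · rw [hS₁]
    ext i
    fin_cases i <;> simp [RCLike.real_smul_eq_coe_mul]

lemma norm_smul_add_smul_le (hp : p ≠ 0) (hq : q ≠ 0) {x₁ x₂ : Lplq 𝕜 ι κ p q}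
    (hdisj : ssupp x₁ ∩ ssupp x₂ = ∅) {a b c d : 𝕜} (hac : ‖a‖ ≤ ‖c‖) (hbd : ‖b‖ ≤ ‖d‖) :
    ‖a • x₁ + b • x₂‖ ≤ ‖c • x₁ + d • x₂‖ := by
  refine lp.norm_mono hp fun i => lp.norm_mono hq fun j => ?_
  simp only [lp.coeFn_add, lp.coeFn_smul, Pi.add_apply, Pi.smul_apply]
  rcases disjoint_apply hdisj i j with h | h <;>
    simp only [h, smul_zero, zero_add, add_zero, norm_smul] <;> gcongr

lemma norm_apply_smul_add_smul (hq : 0 < q.toReal) {x₁ x₂ : Lplq 𝕜 ι κ p q}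
    (hdisj : ssupp x₁ ∩ ssupp x₂ = ∅) (i : ι) (a b : 𝕜) :
    ‖a • x₁ i + b • x₂ i‖ ^ p.toReal = (‖a‖ ^ q.toReal * ‖x₁ i‖ ^ q.toReal +
      ‖b‖ ^ q.toReal * ‖x₂ i‖ ^ q.toReal) ^ (p.toReal / q.toReal) := by
  rw [← lp.norm_smul_add_smul_rpow_of_disjoint hq _ _ (disjoint_apply hdisj i),
    ← Real.rpow_mul (norm_nonneg _), mul_div_cancel₀ _ hq.ne']

lemma norm_ofReal_one_add (h : ℝ) : ‖(1 : 𝕜) + (h : 𝕜)‖ = |1 + h| := by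
  rw [← RCLike.ofReal_one, ← RCLike.ofReal_add, RCLike.norm_ofReal]

lemma abs_one_add_mul_re_le (h : ℝ) (a : 𝕜) : |1 + h * RCLike.re a| ≤ ‖1 + (h : 𝕜) * a‖ := by
  simpa using RCLike.abs_re_le_norm (1 + (h : 𝕜) * a)

section Contraction

open Classical

variable {x₁ x₂ : Lplq 𝕜 ι κ p q} {P : Lplq 𝕜 ι κ p q →L[𝕜] Lplq 𝕜 ι κ p q}

/-- The first coordinate of a contractive projection, evaluated at a block of `x₁`. -/
lemma re_coeff_self (hp : 1 < p.toReal) (hq : 1 < q.toReal) (hx₁ : ‖x₁‖ = 1)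
    (hdisj : ssupp x₁ ∩ ssupp x₂ = ∅) (hP : ∀ z, ‖P z‖ ≤ ‖z‖) (hP₁ : P x₁ = x₁) {i : ι} {a b : 𝕜}
    (hi : P (lp.single p i (x₁ i)) = a • x₁ + b • x₂) :
    RCLike.re a = ‖x₁ i‖ ^ p.toReal := by
  have hp0 : 0 < p.toReal := zero_lt_one.trans hp
  have hpne : p ≠ 0 := (ENNReal.toReal_pos_iff.1 hp0).1.ne'
  have hqne : q ≠ 0 := (ENNReal.toReal_pos_iff.1 (zero_lt_one.trans hq)).1.ne'
  have key (h : ℝ) : |1 + h * RCLike.re a| ^ p.toReal ≤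
      1 - ‖x₁ i‖ ^ p.toReal + |1 + h * 1| ^ p.toReal * ‖x₁ i‖ ^ p.toReal := by
    have h₁ := lp.norm_add_single_rpow hp0 x₁ i ((h : 𝕜) • x₁ i)
    rw [show x₁ i + (h : 𝕜) • x₁ i = (1 + (h : 𝕜)) • x₁ i by rw [add_smul, one_smul], norm_smul,
      norm_ofReal_one_add, Real.mul_rpow (abs_nonneg _) (norm_nonneg _), hx₁, Real.one_rpow] at h₁
    rw [mul_one, ← h₁]
    refine Real.rpow_le_rpow (abs_nonneg _) ?_ hp0.le
    refine le_trans ?_ (hP _)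
    have h₂ : P (x₁ + lp.single p i ((h : 𝕜) • x₁ i)) =
        (1 + (h : 𝕜) * a) • x₁ + ((h : 𝕜) * b) • x₂ := by
      rw [lp.single_smul, map_add, map_smul, hi, hP₁]
      module
    rw [h₂]
    have h₃ := norm_smul_add_smul_le hpne hqne hdisj (le_refl ‖1 + (h : 𝕜) * a‖)
      (b := 0) (d := (h : 𝕜) * b) (norm_zero.trans_le (norm_nonneg _))
    rw [zero_smul, add_zero, norm_smul, hx₁, mul_one] at h₃
    exact (abs_one_add_mul_re_le h a).trans h₃
  have hd := (((hasDerivAt_abs_one_add_mul_rpow hp 1).mul_const (‖x₁ i‖ ^ p.toReal)).const_add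
    (1 - ‖x₁ i‖ ^ p.toReal)).sub (hasDerivAt_abs_one_add_mul_rpow hp (RCLike.re a))
  have hmin := IsLocalMin.hasDerivAt_eq_zero (.of_forall fun h => ?_) hd
  · have : p.toReal * (‖x₁ i‖ ^ p.toReal - RCLike.re a) = 0 := by linarith
    rcases mul_eq_zero.1 this with h | h <;> linarith
  · have := key h
    simp only [Pi.sub_apply, zero_mul, add_zero, abs_one, Real.one_rpow]
    linarith

/-- The second coordinate of a contractive projection, evaluated at a block of `x₁`. -/
lemma re_coeff_other (hp : 1 < p.toReal) (hq : 1 < q.toReal) (hx₂ : ‖x₂‖ = 1)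
    (hdisj : ssupp x₁ ∩ ssupp x₂ = ∅) (hP : ∀ z, ‖P z‖ ≤ ‖z‖) (hP₂ : P x₂ = x₂) {i : ι} {a b : 𝕜}
    (hi : P (lp.single p i (x₁ i)) = a • x₁ + b • x₂) :
    RCLike.re b = 0 := by
  have hp0 : 0 < p.toReal := zero_lt_one.trans hp
  have hq0 : 0 < q.toReal := zero_lt_one.trans hq
  have hpne : p ≠ 0 := (ENNReal.toReal_pos_iff.1 hp0).1.ne'
  have hqne : q ≠ 0 := (ENNReal.toReal_pos_iff.1 hq0).1.ne'
  have key (h : ℝ) : |1 + h * RCLike.re b| ^ p.toReal ≤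
      1 - ‖x₂ i‖ ^ p.toReal + (|h| ^ q.toReal * ‖x₁ i‖ ^ q.toReal +
        ‖x₂ i‖ ^ q.toReal) ^ (p.toReal / q.toReal) := by
    have h₁ := lp.norm_add_single_rpow hp0 x₂ i ((h : 𝕜) • x₁ i)
    have hb := norm_apply_smul_add_smul (p := p) hq0 hdisj i (h : 𝕜) 1
    rw [RCLike.norm_ofReal, norm_one, Real.one_rpow, one_mul, one_smul] at hb
    rw [add_comm (x₂ i), hb, hx₂, Real.one_rpow] at h₁
    rw [← h₁]
    refine Real.rpow_le_rpow (abs_nonneg _) ?_ hp0.le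
    refine le_trans ?_ (hP _)
    have h₂ : P (x₂ + lp.single p i ((h : 𝕜) • x₁ i)) =
        ((h : 𝕜) * a) • x₁ + (1 + (h : 𝕜) * b) • x₂ := by
      rw [lp.single_smul, map_add, map_smul, hi, hP₂]
      module
    rw [h₂]
    have h₃ := norm_smul_add_smul_le hpne hqne hdisj (a := 0) (c := (h : 𝕜) * a)
      (norm_zero.trans_le (norm_nonneg _)) (le_refl ‖1 + (h : 𝕜) * b‖)
    rw [zero_smul, zero_add, norm_smul, hx₂, mul_one] at h₃
    exact (abs_one_add_mul_re_le h b).trans h₃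
  have hd := ((hasDerivAt_abs_rpow_mul_add_rpow hq hp (A := ‖x₁ i‖ ^ q.toReal)
    (B := ‖x₂ i‖ ^ q.toReal) (by positivity) (by positivity)).const_add
    (1 - ‖x₂ i‖ ^ p.toReal)).sub (hasDerivAt_abs_one_add_mul_rpow hp (RCLike.re b))
  have hmin := IsLocalMin.hasDerivAt_eq_zero (.of_forall fun h => ?_) hd
  · have : p.toReal * RCLike.re b = 0 := by linarith
    exact (mul_eq_zero.1 this).resolve_left hp0.ne'
  · have := key h
    have h₀ : (‖x₂ i‖ ^ q.toReal) ^ (p.toReal / q.toReal) = ‖x₂ i‖ ^ p.toReal := by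
      rw [← Real.rpow_mul (norm_nonneg _), mul_div_cancel₀ _ hq0.ne']
    simp only [Pi.sub_apply, zero_mul, add_zero, abs_zero, abs_one, Real.one_rpow,
      Real.zero_rpow hq0.ne', zero_add, h₀]
    linarith

/-- If the span is one-complemented then the ratio of block norms is constant on the vector support
of `x₁`. -/
lemma norm_mul_norm_eq (hp : 1 < p.toReal) (hq : 1 < q.toReal) (hpq : p.toReal ≠ q.toReal)
    (hx₁ : ‖x₁‖ = 1) (hx₂ : ‖x₂‖ = 1) (hdisj : ssupp x₁ ∩ ssupp x₂ = ∅)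
    (hF : IsOneComplemented (Submodule.span 𝕜 {x₁, x₂})) {i k : ι} (hi : x₁ i ≠ 0)
    (hk : x₁ k ≠ 0) : ‖x₂ i‖ * ‖x₁ k‖ = ‖x₂ k‖ * ‖x₁ i‖ := by
  have hp0 : 0 < p.toReal := zero_lt_one.trans hp
  have hq0 : 0 < q.toReal := zero_lt_one.trans hq
  have hpne : p ≠ 0 := (ENNReal.toReal_pos_iff.1 hp0).1.ne'
  have hqne : q ≠ 0 := (ENNReal.toReal_pos_iff.1 hq0).1.ne'
  rcases eq_or_ne i k with rfl | hik
  · rfl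
  obtain ⟨P, hPP, hPn, hPr⟩ := hF
  have hP (z) : ‖P z‖ ≤ ‖z‖ := by simpa [hPn] using P.le_opNorm z
  have hfix (z) (hz : z ∈ Submodule.span 𝕜 {x₁, x₂}) : P z = z := by
    rw [← hPr] at hz
    obtain ⟨w, rfl⟩ := hz
    exact hPP w
  have hP₁ : P x₁ = x₁ := hfix _ (Submodule.subset_span (by simp))
  have hP₂ : P x₂ = x₂ := hfix _ (Submodule.subset_span (by simp))
  have hcoeff (z) : ∃ a b : 𝕜, P z = a • x₁ + b • x₂ := by
    have : P z ∈ Submodule.span 𝕜 {x₁, x₂} := hPr ▸ ⟨z, rfl⟩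
    obtain ⟨a, b, h⟩ := Submodule.mem_span_pair.1 this
    exact ⟨a, b, h.symm⟩
  obtain ⟨a, b, hab⟩ := hcoeff (lp.single p i (x₁ i))
  obtain ⟨c, d, hcd⟩ := hcoeff (lp.single p k (x₁ k))
  have ha := re_coeff_self hp hq hx₁ hdisj hP hP₁ hab
  have hb := re_coeff_other hp hq hx₂ hdisj hP hP₂ hab
  have hc := re_coeff_self hp hq hx₁ hdisj hP hP₁ hcd
  have hd := re_coeff_other hp hq hx₂ hdisj hP hP₂ hcd
  have hi0 : 0 < ‖x₁ i‖ := norm_pos_iff.2 hi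
  have hk0 : 0 < ‖x₁ k‖ := norm_pos_iff.2 hk
  set s : ℝ := (‖x₁ i‖ ^ p.toReal)⁻¹ with hs
  set t : ℝ := (‖x₁ k‖ ^ p.toReal)⁻¹ with ht
  have hsa : s * RCLike.re a = 1 := by
    rw [ha, hs, inv_mul_cancel₀ (by positivity)]
  have htc : t * RCLike.re c = 1 := by
    rw [hc, ht, inv_mul_cancel₀ (by positivity)]
  set N : ι → ℝ → ℝ → ℝ := fun l r h => (|1 + h * r| ^ q.toReal * ‖x₁ l‖ ^ q.toReal +
    ‖x₂ l‖ ^ q.toReal) ^ (p.toReal / q.toReal)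
  have hNeq (l : ι) (r h : ℝ) : ‖(x₁ + x₂) l + ((h * r : ℝ) : 𝕜) • x₁ l‖ ^ p.toReal = N l r h := by
    have := norm_apply_smul_add_smul (p := p) hq0 hdisj l (1 + ((h * r : ℝ) : 𝕜)) 1
    rw [norm_ofReal_one_add, norm_one, Real.one_rpow, one_mul] at this
    refine Eq.trans ?_ this
    rw [lp.coeFn_add, Pi.add_apply]
    congr 2
    module
  have hN0 (l : ι) (r : ℝ) : ‖(x₁ + x₂) l‖ ^ p.toReal = N l r 0 := by
    simpa using hNeq l r 0
  have key (h : ℝ) : N i s 0 + N k (-t) 0 ≤ N i s h + N k (-t) h := by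
    have h₁ := lp.norm_add_single_rpow hp0
      (x₁ + x₂ + lp.single p i (((h * s : ℝ) : 𝕜) • x₁ i)) k (((h * -t : ℝ) : 𝕜) • x₁ k)
    have h₂ : (x₁ + x₂ + lp.single p i (((h * s : ℝ) : 𝕜) • x₁ i) : Lplq 𝕜 ι κ p q) k = (x₁ + x₂) k := by
      rw [lp.coeFn_add, Pi.add_apply, lp.single_apply_ne _ _ _ hik.symm, add_zero]
    rw [h₂, lp.norm_add_single_rpow hp0 (x₁ + x₂) i, hNeq, hNeq, hN0 i s, hN0 k (-t)] at h₁
    have h₃ : P (x₁ + x₂ + lp.single p i (((h * s : ℝ) : 𝕜) • x₁ i) +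
          lp.single p k (((h * -t : ℝ) : 𝕜) • x₁ k)) =
        (1 + (h : 𝕜) * ((s : 𝕜) * a - (t : 𝕜) * c)) • x₁ +
          (1 + (h : 𝕜) * ((s : 𝕜) * b - (t : 𝕜) * d)) • x₂ := by
      rw [lp.single_smul, lp.single_smul, map_add, map_add, map_add, map_smul, map_smul, hab, hcd,
        hP₁, hP₂]
      push_cast
      module
    have h₄ := hP (x₁ + x₂ + lp.single p i (((h * s : ℝ) : 𝕜) • x₁ i) +
          lp.single p k (((h * -t : ℝ) : 𝕜) • x₁ k))
    rw [h₃] at h₄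
    have h₅ : ‖(1 : 𝕜)‖ ≤ ‖1 + (h : 𝕜) * ((s : 𝕜) * a - (t : 𝕜) * c)‖ := by
      have := abs_one_add_mul_re_le h ((s : 𝕜) * a - (t : 𝕜) * c)
      simpa [hsa, htc] using this
    have h₆ : ‖(1 : 𝕜)‖ ≤ ‖1 + (h : 𝕜) * ((s : 𝕜) * b - (t : 𝕜) * d)‖ := by
      have := abs_one_add_mul_re_le h ((s : 𝕜) * b - (t : 𝕜) * d)
      simpa [hb, hd] using this
    have h₇ := (norm_smul_add_smul_le hpne hqne hdisj h₅ h₆).trans h₄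
    rw [one_smul, one_smul] at h₇
    have h₈ := Real.rpow_le_rpow (norm_nonneg _) h₇ hp0.le
    linarith
  have hdi := hasDerivAt_abs_one_add_mul_rpow_mul_add_rpow hq (p.toReal / q.toReal) s
    (A := ‖x₁ i‖ ^ q.toReal) (B := ‖x₂ i‖ ^ q.toReal) (by positivity) (by positivity)
  have hdk := hasDerivAt_abs_one_add_mul_rpow_mul_add_rpow hq (p.toReal / q.toReal) (-t)
    (A := ‖x₁ k‖ ^ q.toReal) (B := ‖x₂ k‖ ^ q.toReal) (by positivity) (by positivity)
  have hmin := IsLocalMin.hasDerivAt_eq_zero (.of_forall fun h => key h) (hdi.add hdk)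
  refine rpow_ratio_injective hq0 hpq hi0 (norm_nonneg _) hk0 (norm_nonneg _) ?_
  rw [← hs, ← ht, ← sub_eq_zero]
  have hmin' : p.toReal * (s * ‖x₁ i‖ ^ q.toReal *
      (‖x₁ i‖ ^ q.toReal + ‖x₂ i‖ ^ q.toReal) ^ (p.toReal / q.toReal - 1) -
      t * ‖x₁ k‖ ^ q.toReal *
      (‖x₁ k‖ ^ q.toReal + ‖x₂ k‖ ^ q.toReal) ^ (p.toReal / q.toReal - 1)) = 0 := by
    rw [← hmin]
    field_simp
    ring
  exact (mul_eq_zero.1 hmin').resolve_left hp0.ne'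

lemma vsupp_subset_of_mem (hp : 1 < p.toReal) (hq : 1 < q.toReal) (hpq : p.toReal ≠ q.toReal)
    (hx₁ : ‖x₁‖ = 1) (hx₂ : ‖x₂‖ = 1) (hdisj : ssupp x₁ ∩ ssupp x₂ = ∅)
    (hF : IsOneComplemented (Submodule.span 𝕜 {x₁, x₂})) {i : ι} (hi₁ : x₁ i ≠ 0) (hi₂ : x₂ i ≠ 0) :
    vsupp x₁ ⊆ vsupp x₂ := by
  intro k (hk : x₁ k ≠ 0) (h : x₂ k = 0)
  have := norm_mul_norm_eq hp hq hpq hx₁ hx₂ hdisj hF hi₁ hk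
  simp [h, hi₂, hk] at this

lemma vsupp_eq_and_norm_apply_eq (hp : 1 < p.toReal) (hq : 1 < q.toReal)
    (hpq : p.toReal ≠ q.toReal) (hx₁ : ‖x₁‖ = 1) (hx₂ : ‖x₂‖ = 1) (hdisj : ssupp x₁ ∩ ssupp x₂ = ∅)
    (hF : IsOneComplemented (Submodule.span 𝕜 {x₁, x₂})) {i : ι} (hi₁ : x₁ i ≠ 0)
    (hi₂ : x₂ i ≠ 0) :
    vsupp x₁ = vsupp x₂ ∧ ∀ k ∈ vsupp x₁, ‖x₁ k‖ = ‖x₂ k‖ := by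
  have hpne : p ≠ 0 := (ENNReal.toReal_pos_iff.1 (zero_lt_one.trans hp)).1.ne'
  have hsupp : vsupp x₁ = vsupp x₂ :=
    (vsupp_subset_of_mem hp hq hpq hx₁ hx₂ hdisj hF hi₁ hi₂).antisymm
      (vsupp_subset_of_mem hp hq hpq hx₂ hx₁ (Set.inter_comm _ _ ▸ hdisj)
        (Set.pair_comm x₁ x₂ ▸ hF) hi₂ hi₁)
  have hi0 : 0 < ‖x₁ i‖ := norm_pos_iff.2 hi₁
  set r : ℝ := ‖x₂ i‖ / ‖x₁ i‖ with hr
  have hr0 : 0 ≤ r := by positivity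
  have hblock (k : ι) : ‖x₂ k‖ = ‖((r : 𝕜) • x₁) k‖ := by
    rw [lp.coeFn_smul, Pi.smul_apply, norm_smul, RCLike.norm_ofReal, abs_of_nonneg hr0]
    by_cases hk : x₁ k = 0
    · have hk₂ : x₂ k = 0 := by
        by_contra h
        have : k ∈ vsupp x₁ := hsupp ▸ h
        exact this hk
      rw [hk, hk₂, norm_zero, mul_zero]
    · have := norm_mul_norm_eq hp hq hpq hx₁ hx₂ hdisj hF hi₁ hk
      rw [hr]
      field_simp
      linarith
  have hnorm : ‖x₂‖ = ‖(r : 𝕜) • x₁‖ :=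
    le_antisymm (lp.norm_mono hpne fun k => (hblock k).le)
      (lp.norm_mono hpne fun k => (hblock k).ge)
  rw [norm_smul, RCLike.norm_ofReal, abs_of_nonneg hr0, hx₁, hx₂, mul_one] at hnorm
  refine ⟨hsupp, fun k _ => ?_⟩
  rw [hblock k, ← hnorm]
  simp

end Contraction

end Lplq

/-- For `1 < p, q < ∞`, `p ≠ q`, and norm-one, scalarly disjointly
supported `x¹, x² ∈ ℓ_p(ℓ_q)`, the span `F` of `{x¹, x²}` is 1-complemented iff (a) the
vector supports are disjoint, or (b) the vector supports coincide and the blockwise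
`ℓ_q`-norms agree; moreover, in case (a) `F` is isometric to `ℓ_p²` and in case (b) `F`
is isometric to `ℓ_q²`. -/
theorem disjoint_pair_one_complemented_iff
    {𝕜 : Type*} [RCLike 𝕜] {ι κ : Type*} [Countable ι] [Countable κ]
    (p q : ℝ≥0∞) [Fact (1 ≤ p)] [Fact (1 ≤ q)]
    (hp1 : 1 < p) (hpt : p ≠ ∞) (hq1 : 1 < q) (hqt : q ≠ ∞) (hpq : p ≠ q)
    (x₁ x₂ : Lplq 𝕜 ι κ p q) (hx₁ : ‖x₁‖ = 1) (hx₂ : ‖x₂‖ = 1)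
    (hdisj : Lplq.ssupp x₁ ∩ Lplq.ssupp x₂ = ∅) :
    (IsOneComplemented (Submodule.span 𝕜 {x₁, x₂}) ↔
      (Lplq.vsupp x₁ ∩ Lplq.vsupp x₂ = ∅ ∨
        (Lplq.vsupp x₁ = Lplq.vsupp x₂ ∧
          ∀ i ∈ Lplq.vsupp x₁, ‖x₁ i‖ = ‖x₂ i‖))) ∧
    (Lplq.vsupp x₁ ∩ Lplq.vsupp x₂ = ∅ →
      Nonempty ((Submodule.span 𝕜 {x₁, x₂} : Submodule 𝕜 (Lplq 𝕜 ι κ p q))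
        ≃ₗᵢ[𝕜] PiLp p (fun _ : Fin 2 => 𝕜))) ∧
    ((Lplq.vsupp x₁ = Lplq.vsupp x₂ ∧ ∀ i ∈ Lplq.vsupp x₁, ‖x₁ i‖ = ‖x₂ i‖) →
      Nonempty ((Submodule.span 𝕜 {x₁, x₂} : Submodule 𝕜 (Lplq 𝕜 ι κ p q))
        ≃ₗᵢ[𝕜] PiLp q (fun _ : Fin 2 => 𝕜))) := by
  have hp : 1 < p.toReal := by
    simpa using (ENNReal.toReal_lt_toReal ENNReal.one_ne_top hpt).2 hp1
  have hq : 1 < q.toReal := by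
    simpa using (ENNReal.toReal_lt_toReal ENNReal.one_ne_top hqt).2 hq1
  have hpq' : p.toReal ≠ q.toReal := fun h => hpq ((ENNReal.toReal_eq_toReal_iff' hpt hqt).1 h)
  have hp0 : 0 < p.toReal := zero_lt_one.trans hp
  have hq0 : 0 < q.toReal := zero_lt_one.trans hq
  refine ⟨⟨fun h => ?_, ?_⟩, fun h => ?_, fun h => ?_⟩
  · by_cases hv : Lplq.vsupp x₁ ∩ Lplq.vsupp x₂ = ∅
    · exact Or.inl hv
    · obtain ⟨i, hi₁, hi₂⟩ := Set.nonempty_iff_ne_empty.2 hv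
      exact Or.inr (Lplq.vsupp_eq_and_norm_apply_eq hp hq hpq' hx₁ hx₂ hdisj h hi₁ hi₂)
  · rintro (h | h)
    · exact Lplq.isOneComplemented_of_vsupp_disjoint hp0 hx₁ hx₂ h
    · exact Lplq.isOneComplemented_of_norm_apply_eq hp hq0 hx₁ hdisj (Lplq.norm_apply_eq h)
  · obtain ⟨T, -, hT⟩ := exists_linearIsometry_pair hp0 x₁ x₂
      (Lplq.norm_rpow_of_vsupp_disjoint (𝕜 := 𝕜) hp0 hx₁ hx₂ h)
    exact ⟨(T.equivRange.trans (LinearIsometryEquiv.ofEq _ _ hT)).symm⟩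
  · obtain ⟨T, -, hT⟩ := exists_linearIsometry_pair hq0 x₁ x₂
      (Lplq.norm_rpow_of_norm_apply_eq (𝕜 := 𝕜) hp0 hq0 hx₁ hdisj (Lplq.norm_apply_eq h))
    exact ⟨(T.equivRange.trans (LinearIsometryEquiv.ofEq _ _ hT)).symm⟩
end
end

section
/- Let 1 ≤ p, q < ∞ with p ≠ q, and let F ⊆ ℓ_p(ℓ_q) be a 2-dimensional subspace that is isometrically isomorphic to ℓ₂² and is 1-complemented in ℓ_p(ℓ_q). Then at least one of the following holds: (a) F is spanned by two vectors with disjoint scalar supports; (b) p = 2; or (c) q = 2 and there exists a surjective linear isometry U of ℓ_p(ℓ_q) such that UF is spanned by two vectors with disjoint scalar supports. -/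
noncomputable section
open scoped ENNReal ComplexConjugate

section Reflections

variable {𝕜 H : Type*} [RCLike 𝕜] [NormedAddCommGroup H] [InnerProductSpace 𝕜 H]

/-- A unitary carrying `u` to a multiple of the unit vector `w` and fixing everything orthogonal
to both. -/
theorem exists_unitary_smul_eq (u w : H) (hw : ‖w‖ = 1) :
    ∃ U : H ≃ₗᵢ[𝕜] H, ∃ a : 𝕜, U u = a • w ∧
      ∀ z, inner 𝕜 u z = 0 → inner 𝕜 w z = 0 → U z = z := by
  obtain ⟨c, hc, hcw⟩ := RCLike.exists_norm_eq_mul_self (inner 𝕜 u w)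
  set a : 𝕜 := (‖u‖ : 𝕜) * c with ha
  have hnorm : ‖a • w‖ = ‖u‖ := by simp [ha, norm_smul, hc, hw]
  have hreal : inner 𝕜 u (a • w) = ((‖u‖ * ‖inner 𝕜 u w‖ : ℝ) : 𝕜) := by
    rw [inner_smul_right, ha, mul_assoc, ← hcw]; push_cast; rfl
  have hsymm : inner 𝕜 (a • w) u = inner 𝕜 u (a • w) := by
    rw [← inner_conj_symm, hreal, RCLike.conj_ofReal]
  set R : H ≃ₗᵢ[𝕜] H := (Submodule.span 𝕜 {u - a • w})ᗮ.reflection with hR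
  have h₁ : R (u - a • w) = -(u - a • w) :=
    Submodule.reflection_orthogonalComplement_singleton_eq_neg _
  have h₂ : R (u + a • w) = u + a • w := by
    apply Submodule.reflection_mem_subspace_eq_self
    rw [Submodule.mem_orthogonal_singleton_iff_inner_left]
    rw [inner_add_left, inner_sub_right, inner_sub_right, hsymm,
      inner_self_eq_norm_sq_to_K, inner_self_eq_norm_sq_to_K, hnorm]
    ring
  refine ⟨R, a, ?_, fun z hz hz' => ?_⟩
  · have h : (2 : 𝕜) • R u = (2 : 𝕜) • (a • w) := by
      have : R u + R u = a • w + a • w := by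
        convert! congr_arg₂ (· + ·) h₂ h₁ using 1
        · simp
        · abel
      simpa [two_smul] using this
    exact smul_right_injective H (two_ne_zero' 𝕜) h
  · apply Submodule.reflection_mem_subspace_eq_self
    rw [Submodule.mem_orthogonal_singleton_iff_inner_right, inner_sub_left, inner_smul_left, hz, hz']
    simp

/-- A unitary carrying an orthogonal pair into the lines spanned by an orthonormal pair. -/
theorem exists_unitary_smul_eq_pair {u v w₁ w₂ : H} (huv : inner 𝕜 u v = 0)
    (hw₁ : ‖w₁‖ = 1) (hw₂ : ‖w₂‖ = 1) (hw : inner 𝕜 w₁ w₂ = 0) :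
    ∃ U : H ≃ₗᵢ[𝕜] H, ∃ a b : 𝕜, U u = a • w₁ ∧ U v = b • w₂ := by
  obtain ⟨U₁, a, ha, -⟩ := exists_unitary_smul_eq (𝕜 := 𝕜) u w₁ hw₁
  obtain ⟨U₂, b, hb, hfix⟩ := exists_unitary_smul_eq (𝕜 := 𝕜) (U₁ v) w₂ hw₂
  refine ⟨U₁.trans U₂, a, b, ?_, by simpa using hb⟩
  rw [LinearIsometryEquiv.trans_apply, hfix, ha]
  · rw [inner_eq_zero_symm, U₁.inner_map_map, huv]
  · rw [ha, inner_smul_right, inner_eq_zero_symm.1 hw, mul_zero]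

theorem inner_map_map_of_norm_map_eq_mul {E : Type*} [NormedAddCommGroup E]
    [InnerProductSpace 𝕜 E] (S : E →ₗ[𝕜] H) (C : ℝ) (hS : ∀ x, ‖S x‖ = C * ‖x‖) (x y : E) :
    inner 𝕜 (S x) (S y) = (C : 𝕜) ^ 2 * inner 𝕜 x y := by
  rw [inner_eq_sum_norm_sq_div_four, inner_eq_sum_norm_sq_div_four (𝕜 := 𝕜) x y]
  simp only [← map_add, ← map_sub, ← map_smul, hS]
  push_cast
  ring

end Reflections

section lpMap

variable {𝕜 ι : Type*} [RCLike 𝕜] {E : ι → Type*} [∀ i, NormedAddCommGroup (E i)]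
  [∀ i, NormedSpace 𝕜 (E i)] {p : ℝ≥0∞} [Fact (1 ≤ p)]

/-- The surjective isometry of an `lp` space acting coordinatewise by surjective isometries. -/
def lpCongr (hp : p ≠ ∞) (U : ∀ i, E i ≃ₗᵢ[𝕜] E i) : lp E p ≃ₗᵢ[𝕜] lp E p where
  toFun x := ⟨fun i => U i (x i), .of_norm (by simpa using (lp.memℓp x).norm)⟩
  invFun x := ⟨fun i => (U i).symm (x i), .of_norm (by simpa using (lp.memℓp x).norm)⟩
  map_add' x y := by ext i; exact map_add (U i) _ _
  map_smul' c x := by ext i; simp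
  left_inv x := by ext i; simp
  right_inv x := by ext i; simp
  norm_map' x := by
    have hp' : 0 < p.toReal :=
      ENNReal.toReal_pos (zero_lt_one.trans_le Fact.out).ne' hp
    rw [lp.norm_eq_tsum_rpow hp', lp.norm_eq_tsum_rpow hp']
    simp

theorem lpCongr_apply (hp : p ≠ ∞) (U : ∀ i, E i ≃ₗᵢ[𝕜] E i) (x : lp E p) (i : ι) :
    lpCongr hp U x i = U i (x i) := rfl

end lpMap

theorem lp_norm_add_single_rpow {ι : Type*} [DecidableEq ι] {E : ι → Type*}
    [∀ i, NormedAddCommGroup (E i)] {p : ℝ≥0∞} (hp : 0 < p.toReal) (x : lp E p) (i : ι) (z : E i) :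
    ‖x + lp.single p i z‖ ^ p.toReal =
      ‖x‖ ^ p.toReal - ‖x i‖ ^ p.toReal + ‖x i + z‖ ^ p.toReal := by
  have h₁ := lp.norm_sub_norm_compl_sub_single hp x {i}
  have h₂ := lp.norm_sub_norm_compl_sub_single hp (x + lp.single p i z) {i}
  have h₃ : x + lp.single p i z - lp.single p i ((x + lp.single p i z) i) =
      x - lp.single p i (x i) := by
    rw [lp.coeFn_add, Pi.add_apply, lp.single_apply_self, lp.single_add]; abel
  simp only [Finset.sum_singleton] at h₁ h₂
  rw [h₃, lp.coeFn_add, Pi.add_apply, lp.single_apply_self] at h₂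
  linarith


theorem hasDerivAt_mixed_norm {P Q N n b : ℝ} (hP : 0 < P) (hQ : 0 < Q) (hN : 0 < N) (hn : 0 < n)
    (hb : 0 < b) :
    HasDerivAt (fun s : ℝ => (N ^ P - n ^ P + (n ^ Q - b ^ Q + ((1 + s) * b) ^ Q) ^ (P / Q)) ^ P⁻¹)
      (N ^ (1 - P) * n ^ (P - Q) * b ^ Q) 0 := by
  have h₁ : HasDerivAt (fun s : ℝ => (1 + s) * b) b 0 := by
    simpa using ((hasDerivAt_id (0 : ℝ)).const_add 1).mul_const b
  have h₂ := ((h₁.rpow_const (p := Q) (by left; simp [hb.ne'])).const_add (n ^ Q - b ^ Q))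
  have hnQ : n ^ Q - b ^ Q + ((1 + 0) * b) ^ Q = n ^ Q := by simp
  have hnQ' : 0 < n ^ Q := by positivity
  have h₃ := (h₂.rpow_const (p := P / Q) (by left; rw [hnQ]; exact hnQ'.ne')).const_add
    (N ^ P - n ^ P)
  have hnP : (n ^ Q) ^ (P / Q) = n ^ P := by rw [← Real.rpow_mul hn.le]; congr 1; field_simp
  have hNP : N ^ P - n ^ P + (n ^ Q - b ^ Q + ((1 + 0) * b) ^ Q) ^ (P / Q) = N ^ P := by
    rw [hnQ, hnP]; ring
  have hNP' : 0 < N ^ P := by positivity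
  have h₄ := h₃.rpow_const (p := P⁻¹) (by left; rw [hNP]; exact hNP'.ne')
  convert h₄ using 1
  rw [hNP, hnQ, ← Real.rpow_mul hN.le, ← Real.rpow_mul hn.le]
  have e₁ : P * (P⁻¹ - 1) = 1 - P := by field_simp
  have e₂ : Q * (P / Q - 1) = P - Q := by field_simp
  have e₃ : b ^ Q = b * b ^ (Q - 1) := by
    rw [Real.rpow_sub hb, Real.rpow_one]; field_simp
  rw [e₁, e₂, e₃, add_zero, one_mul]
  field_simp

section Support

variable {𝕜 : Type*} [RCLike 𝕜] {ι κ : Type*} {p q : ℝ≥0∞} [Fact (1 ≤ p)] [Fact (1 ≤ q)]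

theorem toReal_pos_of_one_le (hp : p ≠ ∞) : 0 < p.toReal :=
  ENNReal.toReal_pos (zero_lt_one.trans_le Fact.out).ne' hp

/-- The coordinates of a norming functional of `x` at places where `x` does not vanish. -/
theorem re_mul_norming_single [DecidableEq ι] [DecidableEq κ] (hp : p ≠ ∞) (hq : q ≠ ∞)
    {x : Lplq 𝕜 ι κ p q} (f : Lplq 𝕜 ι κ p q →ₗ[𝕜] 𝕜) (hf : ∀ z, ‖f z‖ ≤ ‖x‖ * ‖z‖)
    (hfx : f x = (‖x‖ : 𝕜) ^ 2) {i : ι} {j : κ} (hx : x i j ≠ 0) :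
    RCLike.re (x i j * f (lp.single p i (lp.single q j 1))) =
      ‖x‖ ^ (2 - p.toReal) * ‖x i‖ ^ (p.toReal - q.toReal) * ‖x i j‖ ^ q.toReal := by
  have hP := toReal_pos_of_one_le hp
  have hQ := toReal_pos_of_one_le hq
  have hn : 0 < ‖x i‖ := norm_pos_iff.2 fun h => hx (by rw [h]; rfl)
  have hN : 0 < ‖x‖ := norm_pos_iff.2 fun h => hx (by rw [h]; rfl)
  have hb : 0 < ‖x i j‖ := norm_pos_iff.2 hx
  set δ : Lplq 𝕜 ι κ p q := lp.single p i (lp.single q j 1) with hδ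
  set h : ℝ → ℝ := fun s => (‖x‖ ^ p.toReal - ‖x i‖ ^ p.toReal +
    (‖x i‖ ^ q.toReal - ‖x i j‖ ^ q.toReal + ((1 + s) * ‖x i j‖) ^ q.toReal) ^
      (p.toReal / q.toReal)) ^ p.toReal⁻¹ with hh
  have hh0 : h 0 = ‖x‖ := by
    simp only [hh, add_zero, one_mul, sub_add_cancel]
    rw [← Real.rpow_mul hn.le, mul_div_cancel₀ _ hQ.ne', sub_add_cancel, ← Real.rpow_mul hN.le,
      mul_inv_cancel₀ hP.ne', Real.rpow_one]
  have hnorm : ∀ s : ℝ, -1 < s → ‖x + ((s : 𝕜) * x i j) • δ‖ = h s := by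
    intro s hs
    have e₁ : ((s : 𝕜) * x i j) • δ = lp.single p i (lp.single q j ((s : 𝕜) * x i j)) := by
      rw [hδ, ← lp.single_smul, ← lp.single_smul, smul_eq_mul, mul_one]
    have e₂ : ‖x i j + (s : 𝕜) * x i j‖ = (1 + s) * ‖x i j‖ := by
      rw [show x i j + (s : 𝕜) * x i j = ((1 + s : ℝ) : 𝕜) * x i j by push_cast; ring, norm_mul,
        RCLike.norm_ofReal, abs_of_pos (by linarith)]
    rw [e₁, ← Real.rpow_rpow_inv (norm_nonneg _) hP.ne', lp_norm_add_single_rpow hP]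
    simp only [hh]
    rw [← e₂, ← lp_norm_add_single_rpow hQ, ← Real.rpow_mul (norm_nonneg _),
      mul_div_cancel₀ _ hQ.ne']
  have hd := (((hasDerivAt_mixed_norm hP hQ hN hn hb).const_mul ‖x‖).sub_const (‖x‖ ^ 2)).sub
    ((hasDerivAt_id (0 : ℝ)).mul_const (RCLike.re (x i j * f δ)))
  have hmin : IsLocalMin (fun s => ‖x‖ * h s - ‖x‖ ^ 2 - s * RCLike.re (x i j * f δ)) 0 := by
    filter_upwards [Ioi_mem_nhds (show (-1 : ℝ) < 0 by norm_num)] with s hs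
    rw [hh0, ← hnorm s hs]
    have h₁ := (RCLike.re_le_norm _).trans (hf (x + ((s : 𝕜) * x i j) • δ))
    rw [map_add, map_smul, hfx, smul_eq_mul, mul_assoc, map_add, RCLike.re_ofReal_mul,
      ← RCLike.ofReal_pow, RCLike.ofReal_re] at h₁
    linarith
  have := hmin.hasDerivAt_eq_zero hd
  rw [show (2 : ℝ) - p.toReal = 1 + (1 - p.toReal) by ring, Real.rpow_add hN, Real.rpow_one]
  linarith

/-- On a one-complemented Hilbertian subspace the local contribution of a coordinate to the
norming functional is a constant multiple of that coordinate. -/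
theorem exists_const_of_isOneComplemented (hp : p ≠ ∞) (hq : q ≠ ∞)
    {F : Submodule 𝕜 (Lplq 𝕜 ι κ p q)} {G : Type*} [NormedAddCommGroup G] [InnerProductSpace 𝕜 G]
    (e : F ≃ₗᵢ[𝕜] G) (hcompl : IsOneComplemented F) (i : ι) (j : κ) :
    ∃ c : ℝ, ∀ x ∈ F, x i j ≠ 0 →
      ‖x‖ ^ (2 - p.toReal) * ‖x i‖ ^ (p.toReal - q.toReal) * ‖x i j‖ ^ (q.toReal - 2) = c := by
  classical
  obtain ⟨P, hPP, hP1, hPF⟩ := hcompl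
  have hmem : ∀ z, P z ∈ F := fun z => hPF ▸ LinearMap.mem_range_self P.toLinearMap z
  have hfix : ∀ z ∈ F, P z = z := by
    intro z hz
    rw [← hPF] at hz
    obtain ⟨w, rfl⟩ := hz
    exact hPP w
  set P' : Lplq 𝕜 ι κ p q →ₗ[𝕜] F := P.toLinearMap.codRestrict F hmem
  set δ : Lplq 𝕜 ι κ p q := lp.single p i (lp.single q j 1)
  set B : F → 𝕜 := fun x => inner 𝕜 (e x) (e (P' δ)) with hB
  have key : ∀ x : F, x.1 i j ≠ 0 → RCLike.re (x.1 i j * B x) =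
      ‖x.1‖ ^ (2 - p.toReal) * ‖x.1 i‖ ^ (p.toReal - q.toReal) * ‖x.1 i j‖ ^ q.toReal := by
    intro x hx
    refine re_mul_norming_single hp hq (x := x.1)
      ((innerₛₗ 𝕜 (e x)).comp (e.toLinearEquiv.toLinearMap.comp P')) (fun z => ?_) ?_ hx
    · refine (norm_inner_le_norm (e x) (e (P' z))).trans ?_
      rw [e.norm_map, e.norm_map]
      refine mul_le_mul_of_nonneg_left ?_ (norm_nonneg _)
      exact (P.le_opNorm z).trans (by rw [hP1, one_mul])
    · have hPx : P' x.1 = x := Subtype.ext (hfix x.1 x.2)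
      change inner 𝕜 (e x) (e (P' x.1)) = _
      rw [hPx, inner_self_eq_norm_sq_to_K, e.norm_map]
      rfl
  by_cases hne : ∃ y : F, y.1 i j ≠ 0
  swap
  · exact ⟨0, fun x hx hxij => (hne ⟨⟨x, hx⟩, hxij⟩).elim⟩
  obtain ⟨y₀, hy₀⟩ := hne
  obtain ⟨y, hy⟩ : ∃ y : F, y.1 i j = 1 :=
    ⟨(y₀.1 i j)⁻¹ • y₀, inv_mul_cancel₀ hy₀⟩
  have hadd : ∀ a b, B (a + b) = B a + B b := fun a b => by simp [hB, inner_add_left]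
  have hsmul : ∀ (c : 𝕜) a, B (c • a) = conj c * B a := fun c a => by simp [hB, inner_smul_left]
  have hre : ∀ x : F, x.1 i j = 0 → RCLike.re (B x) = 0 := by
    intro x hx
    have h : ∀ t : ℝ, 0 ≤ t * RCLike.re (B x) + t ^ 2 * RCLike.re (B y) := by
      intro t
      rcases eq_or_ne t 0 with rfl | ht
      · simp
      have hc : (x + (t : 𝕜) • y).1 i j = (t : 𝕜) := by
        change x.1 i j + (t : 𝕜) * y.1 i j = t
        rw [hx, hy]; simp
      have := key (x + (t : 𝕜) • y) (by rw [hc]; exact_mod_cast ht)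
      rw [hc, hadd, hsmul, RCLike.conj_ofReal, RCLike.re_ofReal_mul, map_add,
        RCLike.re_ofReal_mul] at this
      have h0 : 0 ≤ t * (RCLike.re (B x) + t * RCLike.re (B y)) := by rw [this]; positivity
      linarith
    by_contra hBx
    set r := RCLike.re (B x)
    set d := RCLike.re (B y)
    have h1 := h (-r / (2 * (|d| + 1)))
    have hd : 0 < |d| + 1 := by positivity
    have hr : 0 < r ^ 2 := by positivity
    have h2 : -r / (2 * (|d| + 1)) * r + (-r / (2 * (|d| + 1))) ^ 2 * d =
        r ^ 2 * (d - 2 * (|d| + 1)) / (4 * (|d| + 1) ^ 2) := by field_simp; ring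
    rw [h2] at h1
    have h3 : r ^ 2 * (d - 2 * (|d| + 1)) < 0 :=
      mul_neg_of_pos_of_neg hr (by linarith [le_abs_self d, abs_nonneg d])
    exact absurd h1 (not_le.2 (div_neg_of_neg_of_pos h3 (by positivity)))
  have hzero : ∀ x : F, x.1 i j = 0 → B x = 0 := by
    intro x hx
    have h := hre (B x • x) (by change B x * x.1 i j = 0; rw [hx, mul_zero])
    rw [hsmul, RCLike.conj_mul, ← RCLike.ofReal_pow, RCLike.ofReal_re] at h
    simpa using h
  refine ⟨RCLike.re (B y), fun x hx hxij => ?_⟩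
  have hpos : 0 < ‖x i j‖ := norm_pos_iff.2 hxij
  have hBx : B ⟨x, hx⟩ = conj (x i j) * B y := by
    have h := hzero (⟨x, hx⟩ + (-(x i j)) • y) (by
      change x i j + -(x i j) * y.1 i j = 0
      rw [hy]; ring)
    rw [hadd, hsmul, map_neg] at h
    linear_combination h
  have h := key ⟨x, hx⟩ hxij
  rw [hBx, ← mul_assoc, RCLike.mul_conj, ← RCLike.ofReal_pow, RCLike.re_ofReal_mul] at h
  rw [Real.rpow_sub hpos, Real.rpow_two, mul_div_assoc', ← h]
  field_simp

theorem toReal_sub_two_ne_zero {r : ℝ≥0∞} (hr : r ≠ ∞) (hr2 : r ≠ 2) : r.toReal - 2 ≠ 0 := by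
  intro h
  apply hr2
  rw [← ENNReal.ofReal_toReal hr, sub_eq_zero.1 h]
  simp

theorem exists_pos_const_of_isOneComplemented (hp : p ≠ ∞) (hq : q ≠ ∞)
    {F : Submodule 𝕜 (Lplq 𝕜 ι κ p q)} {G : Type*} [NormedAddCommGroup G] [InnerProductSpace 𝕜 G]
    (e : F ≃ₗᵢ[𝕜] G) (hcompl : IsOneComplemented F) (i : ι) (j : κ) :
    ∃ c : ℝ, 0 < c ∧ ∀ x ∈ F, x i j ≠ 0 →
      ‖x‖ ^ (2 - p.toReal) * ‖x i‖ ^ (p.toReal - q.toReal) * ‖x i j‖ ^ (q.toReal - 2) = c := by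
  by_cases hne : ∃ y ∈ F, y i j ≠ 0
  · obtain ⟨c, hc⟩ := exists_const_of_isOneComplemented hp hq e hcompl i j
    obtain ⟨y, hyF, hy⟩ := hne
    refine ⟨c, ?_, hc⟩
    rw [← hc y hyF hy]
    have hn : 0 < ‖y i‖ := norm_pos_iff.2 fun h => hy (by rw [h]; rfl)
    have hN : 0 < ‖y‖ := norm_pos_iff.2 fun h => hy (by rw [h]; rfl)
    have hb : 0 < ‖y i j‖ := norm_pos_iff.2 hy
    positivity
  · exact ⟨1, one_pos, fun x hx hxij => (hne ⟨x, hx, hxij⟩).elim⟩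

theorem eq_mul_of_rpow_mul_rpow_neg {a b c r : ℝ} (ha : 0 < a) (hb : 0 < b) (hr : r ≠ 0)
    (h : a ^ r * b ^ (-r) = c) : a = c ^ r⁻¹ * b := by
  rw [← h, Real.rpow_neg hb.le, ← div_eq_mul_inv, ← Real.div_rpow ha.le hb.le,
    Real.rpow_rpow_inv (div_pos ha hb).le hr, div_mul_cancel₀ _ hb.ne']

/-- A continuous identity on the set where a coordinate does not vanish extends along lines. -/
theorem eq_of_eq_of_apply_ne_zero {F : Submodule 𝕜 (Lplq 𝕜 ι κ p q)} {i : ι} {j : κ}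
    {f g : Lplq 𝕜 ι κ p q → ℝ} (hf : Continuous f) (hg : Continuous g)
    {y : Lplq 𝕜 ι κ p q} (hyF : y ∈ F) (hy : y i j ≠ 0)
    (h : ∀ x ∈ F, x i j ≠ 0 → f x = g x) {x : Lplq 𝕜 ι κ p q} (hx : x ∈ F) : f x = g x := by
  by_cases hxij : x i j = 0
  swap
  · exact h x hx hxij
  have hline : Continuous fun t : ℝ => x + (t : 𝕜) • y :=
    continuous_const.add
      ((RCLike.continuous_ofReal (K := 𝕜)).smul (continuous_const (y := y)))
  have := (hf.comp hline).ext_on (dense_compl_singleton (0 : ℝ)) (hg.comp hline) (by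
    intro t ht
    refine h _ (F.add_mem hx (F.smul_mem _ hyF)) ?_
    change x i j + (t : 𝕜) * y i j ≠ 0
    rw [hxij, zero_add]
    exact mul_ne_zero (by exact_mod_cast ht) hy)
  simpa using congrFun this 0

theorem continuous_apply_lp {ι : Type*} {E : ι → Type*} [∀ i, NormedAddCommGroup (E i)]
    {p : ℝ≥0∞} [Fact (1 ≤ p)] (i : ι) : Continuous fun x : lp E p => x i :=
  (continuous_apply i).comp lp.uniformContinuous_coe.continuous

/-- For `q = 2`, each block is a multiple of an isometry on `F`. -/
theorem exists_norm_apply_eq_mul (hp : p ≠ ∞) (hp2 : p ≠ 2)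
    {F : Submodule 𝕜 (Lplq 𝕜 ι κ p 2)} {G : Type*} [NormedAddCommGroup G] [InnerProductSpace 𝕜 G]
    (e : F ≃ₗᵢ[𝕜] G) (hcompl : IsOneComplemented F) (i : ι) :
    ∃ C : ℝ, ∀ x ∈ F, ‖x i‖ = C * ‖x‖ := by
  by_cases hne : ∃ j, ∃ y ∈ F, y i j ≠ 0
  · obtain ⟨j, y, hyF, hy⟩ := hne
    obtain ⟨c, -, hc⟩ := exists_pos_const_of_isOneComplemented hp (by simp) e hcompl i j
    refine ⟨c ^ (p.toReal - 2)⁻¹, fun x hx => ?_⟩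
    refine eq_of_eq_of_apply_ne_zero (continuous_apply_lp i).norm
      (continuous_const.mul continuous_norm) hyF hy (fun x hx hxij => ?_) hx
    refine eq_mul_of_rpow_mul_rpow_neg (norm_pos_iff.2 fun h => hxij (by rw [h]; rfl))
      (norm_pos_iff.2 fun h => hxij (by rw [h]; rfl)) (toReal_sub_two_ne_zero hp hp2) ?_
    rw [← hc x hx hxij]
    simp [mul_comm]
  · push Not at hne
    refine ⟨0, fun x hx => ?_⟩
    have : x i = 0 := by ext j; exact hne j x hx
    simp [this]

/-- For `p, q ≠ 2` there is no one-complemented Hilbertian subspace of dimension at least two. -/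
theorem false_of_ne_two (hp : p ≠ ∞) (hq : q ≠ ∞) (hp2 : p ≠ 2) (hq2 : q ≠ 2)
    {F : Submodule 𝕜 (Lplq 𝕜 ι κ p q)} {G : Type*} [NormedAddCommGroup G] [InnerProductSpace 𝕜 G]
    (e : F ≃ₗᵢ[𝕜] G) (hdim : 1 < Module.finrank 𝕜 F) (hcompl : IsOneComplemented F) : False := by
  have hfin : FiniteDimensional 𝕜 F := Module.finite_of_finrank_pos (by omega)
  have hcoord : ∀ i j, Continuous fun x : Lplq 𝕜 ι κ p q => x i j := fun i j =>
    (continuous_apply_lp j).comp (continuous_apply_lp i)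
  obtain ⟨i, j, y, hyF, hy⟩ : ∃ i j, ∃ y ∈ F, y i j ≠ 0 := by
    by_contra! h
    have : F = ⊥ := (Submodule.eq_bot_iff _).2 fun x hx => by ext i j; exact h i j x hx
    rw [this] at hdim
    simp at hdim
  obtain ⟨c, hc0, hc⟩ := exists_pos_const_of_isOneComplemented hp hq e hcompl i j
  have hker : ∀ x ∈ F, x i j = 0 → ∀ k, x i k = 0 := by
    intro x hx hxj k
    obtain ⟨d, hd0, hd⟩ := exists_pos_const_of_isOneComplemented hp hq e hcompl i k
    set D : ℝ := (c / d) ^ (q.toReal - 2)⁻¹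
    have hD : 0 < D := by positivity
    have h := eq_of_eq_of_apply_ne_zero (f := fun x => ‖x i j‖ * ‖x i k‖)
      (g := fun x => D * ‖x i k‖ * ‖x i k‖) ((hcoord i j).norm.mul (hcoord i k).norm)
      ((continuous_const.mul (hcoord i k).norm).mul (hcoord i k).norm) hyF hy (fun z hz hzj => by
        rcases eq_or_ne (z i k) 0 with hzk | hzk
        · simp [hzk]
        have hn : 0 < ‖z i‖ := norm_pos_iff.2 fun h => hzj (by rw [h]; rfl)
        have hN : 0 < ‖z‖ := norm_pos_iff.2 fun h => hzj (by rw [h]; rfl)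
        have hk : 0 < ‖z i k‖ := norm_pos_iff.2 hzk
        have hj : 0 < ‖z i j‖ := norm_pos_iff.2 hzj
        have : ‖z i j‖ = D * ‖z i k‖ := by
          refine eq_mul_of_rpow_mul_rpow_neg hj hk (toReal_sub_two_ne_zero hq hq2) ?_
          rw [← hc z hz hzj, ← hd z hz hzk, Real.rpow_neg hk.le]
          field_simp
        simp only [this]) hx
    simp only [hxj, norm_zero, zero_mul] at h
    by_contra hne
    have : 0 < ‖x i k‖ := norm_pos_iff.2 hne
    have : 0 < D * ‖x i k‖ * ‖x i k‖ := by positivity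
    linarith
  have hyi : 0 < ‖y i‖ := norm_pos_iff.2 fun h => hy (by rw [h]; rfl)
  have hyij : 0 < ‖y i j‖ := norm_pos_iff.2 hy
  set K : ℝ := ‖y i‖ / ‖y i j‖ with hK
  have hK0 : 0 < K := by positivity
  have hblock : ∀ x ∈ F, ‖x i‖ = K * ‖x i j‖ := by
    intro x hx
    have h : y i j • x i = x i j • y i := by
      ext k
      have := hker (y i j • x - x i j • y) (F.sub_mem (F.smul_mem _ hx) (F.smul_mem _ hyF))
        (by change y i j * x i j - x i j * y i j = 0; ring) k
      exact sub_eq_zero.1 this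
    have h' := congrArg norm h
    rw [norm_smul, norm_smul] at h'
    rw [hK]
    field_simp
    linarith
  set L : ℝ := (c / K ^ (p.toReal - q.toReal)) ^ (p.toReal - 2)⁻¹
  have hL : 0 < L := by positivity
  have hcoordnorm : ∀ x ∈ F, ‖x i j‖ = L * ‖x‖ := fun x hx =>
    eq_of_eq_of_apply_ne_zero (hcoord i j).norm (continuous_const.mul continuous_norm) hyF hy
      (fun z hz hzj => by
        have hN : 0 < ‖z‖ := norm_pos_iff.2 fun h => hzj (by rw [h]; rfl)
        have hj : 0 < ‖z i j‖ := norm_pos_iff.2 hzj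
        refine eq_mul_of_rpow_mul_rpow_neg hj hN (toReal_sub_two_ne_zero hp hp2) ?_
        rw [← hc z hz hzj, hblock z hz, Real.mul_rpow hK0.le hj.le, neg_sub,
          show p.toReal - 2 = (p.toReal - q.toReal) + (q.toReal - 2) by ring, Real.rpow_add hj]
        field_simp) hx
  let φ : F →ₗ[𝕜] 𝕜 :=
    { toFun := fun x => x.1 i j
      map_add' := fun _ _ => rfl
      map_smul' := fun _ _ => rfl }
  have hφ := φ.ker_ne_bot_of_finrank_lt (by rwa [Module.finrank_self])
  obtain ⟨x, hxφ, hx0⟩ := Submodule.exists_mem_ne_zero_of_ne_bot hφ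
  have hxij : x.1 i j = 0 := hxφ
  have h := hcoordnorm x.1 x.2
  rw [hxij, norm_zero] at h
  have : 0 < ‖x.1‖ := norm_pos_iff.2 fun h => hx0 (Subtype.ext h)
  have : 0 < L * ‖x.1‖ := by positivity
  linarith

end Support

/-- For `1 ≤ p, q < ∞`, `p ≠ q`, if a 2-dimensional subspace
`F ⊆ ℓ_p(ℓ_q)` is isometrically isomorphic to `ℓ₂²` and 1-complemented, then (a) `F` is
spanned by two vectors with disjoint scalar supports, or (b) `p = 2`, or (c) `q = 2` and
there is a surjective linear isometry `U` of `ℓ_p(ℓ_q)` with `U F` spanned by two vectors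
with disjoint scalar supports. -/
theorem l22_subspace_trichotomy
    {𝕜 : Type*} [RCLike 𝕜] {ι κ : Type*} [Countable ι] [Countable κ]
    (p q : ℝ≥0∞) [Fact (1 ≤ p)] [Fact (1 ≤ q)]
    (hpt : p ≠ ∞) (hqt : q ≠ ∞) (hpq : p ≠ q)
    (F : Submodule 𝕜 (Lplq 𝕜 ι κ p q))
    (hdim : Module.finrank 𝕜 F = 2)
    (hiso : Nonempty (F ≃ₗᵢ[𝕜] EuclideanSpace 𝕜 (Fin 2)))
    (hcompl : IsOneComplemented F) :
    (∃ u v : Lplq 𝕜 ι κ p q, Lplq.ssupp u ∩ Lplq.ssupp v = ∅ ∧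
        F = Submodule.span 𝕜 {u, v}) ∨
    p = 2 ∨
    (q = 2 ∧ ∃ U : Lplq 𝕜 ι κ p q ≃ₗᵢ[𝕜] Lplq 𝕜 ι κ p q,
      ∃ u v : Lplq 𝕜 ι κ p q, Lplq.ssupp u ∩ Lplq.ssupp v = ∅ ∧
        F.map U.toLinearEquiv.toLinearMap = Submodule.span 𝕜 {u, v}) := by

  classical
  obtain ⟨e⟩ := hiso
  rcases eq_or_ne p 2 with hp2 | hp2
  · exact .inr (.inl hp2)
  rcases eq_or_ne q 2 with rfl | hq2
  swap
  · exact (false_of_ne_two hpt hqt hp2 hq2 e (by omega) hcompl).elim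
  set u : F := e.symm (EuclideanSpace.single 0 1)
  set v : F := e.symm (EuclideanSpace.single 1 1)
  have hspan : F = Submodule.span 𝕜 {u.1, v.1} := by
    refine le_antisymm (fun x hx => ?_) (Submodule.span_le.2 ?_)
    · have h : (⟨x, hx⟩ : F) = e ⟨x, hx⟩ 0 • u + e ⟨x, hx⟩ 1 • v := by
        rw [← map_smul, ← map_smul, ← map_add, LinearIsometryEquiv.eq_symm_apply]
        ext k
        fin_cases k <;> simp
      exact Submodule.mem_span_pair.2 ⟨_, _, (congrArg Subtype.val h).symm⟩
    · rintro _ (rfl | rfl)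
      exacts [u.2, v.2]
  have horth : ∀ i, inner 𝕜 (u.1 i) (v.1 i) = 0 := by
    intro i
    obtain ⟨C, hC⟩ := exists_norm_apply_eq_mul hpt hp2 e hcompl i
    let S : EuclideanSpace 𝕜 (Fin 2) →ₗ[𝕜] lp (fun _ : κ => 𝕜) 2 :=
      { toFun := fun x => (e.symm x).1 i
        map_add' := fun x y => by rw [map_add]; rfl
        map_smul' := fun c x => by rw [map_smul]; rfl }
    have h := inner_map_map_of_norm_map_eq_mul S C (fun x => by
      rw [← e.symm.norm_map x]; exact hC _ (e.symm x).2)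
      (EuclideanSpace.single 0 1) (EuclideanSpace.single 1 1)
    exact h.trans (by simp [EuclideanSpace.inner_single_left])
  rcases subsingleton_or_nontrivial κ with hκ | hκ
  · refine .inl ⟨u, v, ?_, hspan⟩
    rw [Set.eq_empty_iff_forall_notMem]
    rintro ⟨i, j⟩ ⟨hu, hv⟩
    have h := horth i
    rw [show u.1 i = lp.single 2 j (u.1 i j) by
      ext k; rw [Subsingleton.elim k j, lp.single_apply_self], lp.inner_single_left] at h
    rcases mul_eq_zero.1 h with h | h
    · exact hv h
    · exact hu (by simpa using h)
  · obtain ⟨j₁, j₂, hj⟩ := exists_pair_ne κ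
    have hnorm : ∀ j : κ, ‖(lp.single 2 j (1 : 𝕜) : lp (fun _ : κ => 𝕜) 2)‖ = 1 := fun j => by
      rw [lp.norm_single (by norm_num), norm_one]
    have hw : inner 𝕜 (lp.single 2 j₁ (1 : 𝕜) : lp (fun _ : κ => 𝕜) 2) (lp.single 2 j₂ 1) = 0 := by
      rw [lp.inner_single_left, lp.single_apply_ne _ _ _ hj, inner_zero_right]
    choose U a b hUu hUv using fun i =>
      exists_unitary_smul_eq_pair (horth i) (hnorm j₁) (hnorm j₂) hw
    refine .inr (.inr ⟨rfl, lpCongr hpt U, lpCongr hpt U u, lpCongr hpt U v, ?_, ?_⟩)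
    · rw [Set.eq_empty_iff_forall_notMem]
      rintro ⟨i, j⟩ ⟨hu, hv⟩
      have hju : j = j₁ := by
        by_contra h
        refine hu ?_
        change lpCongr hpt U u i j = 0
        rw [lpCongr_apply, hUu, lp.coeFn_smul, Pi.smul_apply, lp.single_apply_ne _ _ _ h, smul_zero]
      have hjv : j = j₂ := by
        by_contra h
        refine hv ?_
        change lpCongr hpt U v i j = 0
        rw [lpCongr_apply, hUv, lp.coeFn_smul, Pi.smul_apply, lp.single_apply_ne _ _ _ h, smul_zero]
      exact hj (hju.symm.trans hjv)
    · conv_lhs => rw [hspan]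
      rw [Submodule.map_span, Set.image_pair]
      rfl
end
end

section
/- Let a > 0 and let φ : [0, a] → ℝ be an increasing differentiable function with φ(0) = 0, and suppose there exist α, β with 0 < α, β < 1 such that φ(αu) = β·φ(u) for all u ∈ [0, a]. Set p = log β / log α, and suppose that φ is not of the form φ(u) = C·u^p on [0, a] for any constant C. Then there exists γ > 0 such that, for α′ ∈ (0, 1): there exists β′ ∈ (0, 1) with φ(α′u) = β′·φ(u) for all u ∈ [0, a] if and only if α′ = γ^k for some k ∈ ℤ. -/
noncomputable section

/-- The logarithms of the scale factors under which `φ` is homogeneous of degree `p`, as long as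
both arguments lie in `[0, a]`. -/
def logScaleSubgroup (a p : ℝ) (φ : ℝ → ℝ) : AddSubgroup ℝ where
  carrier := {t | ∀ u ∈ Set.Icc (0 : ℝ) a, Real.exp t * u ∈ Set.Icc (0 : ℝ) a →
    φ (Real.exp t * u) = Real.exp (p * t) * φ u}
  zero_mem' := by simp
  add_mem' := by
    intro s t hs ht u hu hstu
    have hs_pos := Real.exp_pos s
    have ht_pos := Real.exp_pos t
    have step : ∀ x y : ℝ, Real.exp (x + y) * u = Real.exp x * (Real.exp y * u) := fun x y => by
      rw [Real.exp_add, mul_assoc]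
    have split : Real.exp t * u ≤ a ∨ Real.exp s * u ≤ a := by
      rcases le_total t 0 with h | h
      · exact Or.inl ((mul_le_of_le_one_left hu.1 (Real.exp_le_one_iff.2 h)).trans hu.2)
      · refine Or.inr (le_trans ?_ hstu.2)
        exact mul_le_mul_of_nonneg_right (Real.exp_le_exp.2 (by linarith)) hu.1
    rcases split with h | h
    · rw [step] at hstu ⊢
      rw [hs _ ⟨mul_nonneg ht_pos.le hu.1, h⟩ hstu, ht u hu ⟨mul_nonneg ht_pos.le hu.1, h⟩,
        mul_add, Real.exp_add, mul_assoc]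
    · rw [add_comm, step] at hstu ⊢
      rw [ht _ ⟨mul_nonneg hs_pos.le hu.1, h⟩ hstu, hs u hu ⟨mul_nonneg hs_pos.le hu.1, h⟩,
        mul_add, Real.exp_add, mul_assoc]
  neg_mem' := by
    intro t ht u hu htu
    have hcancel : Real.exp t * (Real.exp (-t) * u) = u := by
      rw [← mul_assoc, ← Real.exp_add]; simp
    have h := ht _ htu (by rwa [hcancel])
    rw [hcancel] at h
    rw [h, ← mul_assoc, ← Real.exp_add]
    simp

theorem mem_logScaleSubgroup {a p : ℝ} {φ : ℝ → ℝ} {t : ℝ} :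
    t ∈ logScaleSubgroup a p φ ↔ ∀ u ∈ Set.Icc (0 : ℝ) a,
      Real.exp t * u ∈ Set.Icc (0 : ℝ) a → φ (Real.exp t * u) = Real.exp (p * t) * φ u :=
  Iff.rfl

theorem apply_pow_mul_of_apply_mul {a c b : ℝ} {φ : ℝ → ℝ} (hc : c ∈ Set.Ioo (0 : ℝ) 1)
    (h : ∀ u ∈ Set.Icc (0 : ℝ) a, φ (c * u) = b * φ u) (n : ℕ) :
    ∀ u ∈ Set.Icc (0 : ℝ) a, φ (c ^ n * u) = b ^ n * φ u := by
  induction n with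
  | zero => simp
  | succ n ih =>
    intro u hu
    have hmem : c ^ n * u ∈ Set.Icc (0 : ℝ) a :=
      ⟨mul_nonneg (pow_nonneg hc.1.le n) hu.1,
        (mul_le_of_le_one_left hu.1 (pow_le_one₀ hc.1.le hc.2.le)).trans hu.2⟩
    rw [pow_succ', mul_assoc, h _ hmem, ih u hu, pow_succ', mul_assoc]

theorem rpow_log_div_log {x y : ℝ} (hx : x ∈ Set.Ioo (0 : ℝ) 1) (hy : 0 < y) :
    x ^ (Real.log y / Real.log x) = y := by
  rw [Real.rpow_def_of_pos hx.1, mul_div_cancel₀ _ (Real.log_neg hx.1 hx.2).ne, Real.exp_log hy]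

/-- A monotone function that scales by `β` under multiplication by `α` is comparable to the power
function of exponent `log β / log α`, up to a factor of `β`. -/
theorem rpow_bounds_of_apply_mul {a α β : ℝ} {φ : ℝ → ℝ} (ha : 0 < a)
    (hmono : MonotoneOn φ (Set.Icc 0 a)) (hφa : 0 < φ a)
    (hα : α ∈ Set.Ioo (0 : ℝ) 1) (hβ : β ∈ Set.Ioo (0 : ℝ) 1)
    (hmult : ∀ u ∈ Set.Icc (0 : ℝ) a, φ (α * u) = β * φ u)
    {y : ℝ} (hy : 0 < y) (hy1 : y ≤ 1) :
    β * (y ^ (Real.log β / Real.log α) * φ a) ≤ φ (y * a) ∧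
      β * φ (y * a) ≤ y ^ (Real.log β / Real.log α) * φ a := by
  set p := Real.log β / Real.log α with hp
  have hp_pos : 0 < p := div_pos_of_neg_of_neg (Real.log_neg hβ.1 hβ.2) (Real.log_neg hα.1 hα.2)
  obtain ⟨n, hn, hn'⟩ := exists_nat_pow_near_of_lt_one hy hy1 hα.1 hα.2
  have hpow (m : ℕ) : (α ^ m) ^ p = β ^ m := by
    rw [← Real.rpow_natCast, ← Real.rpow_mul hα.1.le, mul_comm, Real.rpow_mul hα.1.le,
      rpow_log_div_log hα hβ.1, Real.rpow_natCast]
  have hmem {z : ℝ} (hz : 0 ≤ z) (hz1 : z ≤ 1) : z * a ∈ Set.Icc 0 a :=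
    ⟨mul_nonneg hz ha.le, mul_le_of_le_one_left ha.le hz1⟩
  have hpow_mem (m : ℕ) : α ^ m * a ∈ Set.Icc 0 a :=
    hmem (pow_nonneg hα.1.le m) (pow_le_one₀ hα.1.le hα.2.le)
  have happly (m : ℕ) : φ (α ^ m * a) = β ^ m * φ a :=
    apply_pow_mul_of_apply_mul hα hmult m a ⟨ha.le, le_rfl⟩
  have hlower : β ^ (n + 1) * φ a ≤ φ (y * a) := by
    rw [← happly]
    exact hmono (hpow_mem _) (hmem hy.le hy1) (mul_le_mul_of_nonneg_right hn.le ha.le)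
  have hupper : φ (y * a) ≤ β ^ n * φ a := by
    rw [← happly]
    exact hmono (hmem hy.le hy1) (hpow_mem _) (mul_le_mul_of_nonneg_right hn' ha.le)
  have hylower : β ^ (n + 1) ≤ y ^ p := by
    rw [← hpow]
    exact Real.rpow_le_rpow (pow_nonneg hα.1.le _) hn.le hp_pos.le
  have hyupper : y ^ p ≤ β ^ n := by
    rw [← hpow]
    exact Real.rpow_le_rpow hy.le hn' hp_pos.le
  constructor
  · calc β * (y ^ p * φ a) ≤ β * (β ^ n * φ a) := by have := hβ.1; gcongr
      _ = β ^ (n + 1) * φ a := by ring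
      _ ≤ φ (y * a) := hlower
  · calc β * φ (y * a) ≤ β * (β ^ n * φ a) := by have := hβ.1; gcongr
      _ = β ^ (n + 1) * φ a := by ring
      _ ≤ y ^ p * φ a := by gcongr

theorem eq_one_of_pow_bounded {b c : ℝ} (hb : 0 < b)
    (hlower : ∀ n : ℕ, b ≤ c ^ n) (hupper : ∀ n : ℕ, b * c ^ n ≤ 1) : c = 1 := by
  rcases lt_trichotomy c 1 with h | h | h
  · obtain ⟨n, hn⟩ := exists_pow_lt_of_lt_one hb h
    exact absurd (hlower n) hn.not_ge
  · exact h
  · obtain ⟨n, hn⟩ := pow_unbounded_of_one_lt b⁻¹ h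
    refine absurd (hupper n) (not_le.2 ?_)
    rwa [inv_lt_iff_one_lt_mul₀' hb] at hn

/-- All scale factors of a monotone function share the same exponent. -/
theorem eq_rpow_of_apply_mul {a α β α' β' : ℝ} {φ : ℝ → ℝ} (ha : 0 < a)
    (hmono : MonotoneOn φ (Set.Icc 0 a)) (hφa : 0 < φ a)
    (hα : α ∈ Set.Ioo (0 : ℝ) 1) (hβ : β ∈ Set.Ioo (0 : ℝ) 1)
    (hmult : ∀ u ∈ Set.Icc (0 : ℝ) a, φ (α * u) = β * φ u)
    (hα' : α' ∈ Set.Ioo (0 : ℝ) 1)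
    (hmult' : ∀ u ∈ Set.Icc (0 : ℝ) a, φ (α' * u) = β' * φ u) :
    β' = α' ^ (Real.log β / Real.log α) := by
  set p := Real.log β / Real.log α with hp
  have hpos : 0 < α' ^ p := Real.rpow_pos_of_pos hα'.1 p
  have key (n : ℕ) : β * (α' ^ p) ^ n ≤ β' ^ n ∧ β * β' ^ n ≤ (α' ^ p) ^ n := by
    have hb := rpow_bounds_of_apply_mul ha hmono hφa hα hβ hmult (pow_pos hα'.1 n)
      (pow_le_one₀ hα'.1.le hα'.2.le)
    rw [apply_pow_mul_of_apply_mul hα' hmult' n a ⟨ha.le, le_rfl⟩, ← hp,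
      ← Real.rpow_pow_comm hα'.1.le, ← mul_assoc, ← mul_assoc] at hb
    exact ⟨le_of_mul_le_mul_right hb.1 hφa, le_of_mul_le_mul_right hb.2 hφa⟩
  have hratio : β' / α' ^ p = 1 := by
    refine eq_one_of_pow_bounded hβ.1 (fun n => ?_) (fun n => ?_)
    · rw [div_pow, le_div_iff₀ (pow_pos hpos n)]
      exact (key n).1
    · rw [div_pow, ← mul_div_assoc, div_le_one (pow_pos hpos n)]
      exact (key n).2
  exact (div_eq_one_iff_eq hpos.ne').1 hratio

theorem apply_exp_mul_of_dense_logScaleSubgroup {a p : ℝ} {φ : ℝ → ℝ} (ha : 0 < a)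
    (hcont : ContinuousOn φ (Set.Icc 0 a))
    (hdense : Dense (logScaleSubgroup a p φ : Set ℝ)) {t : ℝ} (ht : t ≤ 0) :
    φ (Real.exp t * a) = Real.exp (p * t) * φ a := by
  have hmem : ∀ x ∈ Set.Iic (0 : ℝ), Real.exp x * a ∈ Set.Icc 0 a := fun x hx =>
    ⟨by positivity, mul_le_of_le_one_left ha.le (Real.exp_le_one_iff.2 hx)⟩
  have heq : Set.EqOn (fun x => φ (Real.exp x * a)) (fun x => Real.exp (p * x) * φ a)
      (Set.Iio 0 ∩ (logScaleSubgroup a p φ : Set ℝ)) := fun x hx =>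
    mem_logScaleSubgroup.1 hx.2 a ⟨ha.le, le_rfl⟩ (hmem x (Set.Iio_subset_Iic_self hx.1))
  refine heq.of_subset_closure (t := Set.Iic 0) (hcont.comp (by fun_prop) hmem) (by fun_prop)
    (fun x hx => Set.Iio_subset_Iic_self hx.1) ?_ ht
  rw [← closure_Iio]
  exact closure_minimal (hdense.open_subset_closure_inter isOpen_Iio) isClosed_closure

/-- Let `φ : [0, a] → ℝ` be increasing, differentiable, `φ 0 = 0`, with
`φ (α * u) = β * φ u` on `[0, a]` for some `α, β ∈ (0, 1)`; set `p = log β / log α` and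
suppose `φ` is not of the form `C * u ^ p` on `[0, a]`. Then there is `γ > 0` such that an
`α' ∈ (0, 1)` satisfies `φ (α' * u) = β' * φ u` on `[0, a]` for some `β' ∈ (0, 1)` iff
`α' = γ ^ k` for some integer `k`. -/
theorem multiplicative_scalars_powers_of_gamma
    (a : ℝ) (ha : 0 < a) (φ : ℝ → ℝ)
    (hmono : StrictMonoOn φ (Set.Icc 0 a))
    (hdiff : DifferentiableOn ℝ φ (Set.Icc 0 a))
    (hφ0 : φ 0 = 0)
    (α β : ℝ) (hα : α ∈ Set.Ioo (0 : ℝ) 1) (hβ : β ∈ Set.Ioo (0 : ℝ) 1)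
    (hmult : ∀ u ∈ Set.Icc (0 : ℝ) a, φ (α * u) = β * φ u)
    (hnotpow : ¬ ∃ C : ℝ, ∀ u ∈ Set.Icc (0 : ℝ) a,
      φ u = C * u ^ (Real.log β / Real.log α)) :
    ∃ γ : ℝ, 0 < γ ∧
      ∀ α' ∈ Set.Ioo (0 : ℝ) 1,
        ((∃ β' ∈ Set.Ioo (0 : ℝ) 1, ∀ u ∈ Set.Icc (0 : ℝ) a, φ (α' * u) = β' * φ u) ↔
          ∃ k : ℤ, α' = γ ^ k) := by
  set p := Real.log β / Real.log α with hp
  have hp_pos : 0 < p := div_pos_of_neg_of_neg (Real.log_neg hβ.1 hβ.2) (Real.log_neg hα.1 hα.2)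
  have hφa : 0 < φ a := hφ0 ▸ hmono ⟨le_rfl, ha.le⟩ ⟨ha.le, le_rfl⟩ ha
  rcases (logScaleSubgroup a p φ).dense_or_cyclic with hdense | ⟨g, hg⟩
  · refine absurd ⟨φ a / a ^ p, fun u hu => ?_⟩ hnotpow
    rcases hu.1.eq_or_lt with rfl | hu_pos
    · rw [hφ0, Real.zero_rpow hp_pos.ne', mul_zero]
    have hua : 0 < u / a := div_pos hu_pos ha
    have h := apply_exp_mul_of_dense_logScaleSubgroup ha hdiff.continuousOn hdense
      (Real.log_nonpos hua.le ((div_le_one ha).2 hu.2))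
    rw [Real.exp_log hua, div_mul_cancel₀ _ ha.ne', mul_comm p, ← Real.rpow_def_of_pos hua,
      Real.div_rpow hu_pos.le ha.le] at h
    rw [h]
    ring
  · refine ⟨Real.exp g, Real.exp_pos g, fun α' hα' => ?_⟩
    have hlog : Real.log α' ∈ logScaleSubgroup a p φ ↔ ∃ k : ℤ, α' = Real.exp g ^ k := by
      rw [hg, AddSubgroup.mem_closure_singleton]
      refine exists_congr fun k => ?_
      rw [← Real.rpow_intCast, ← Real.exp_mul, mul_comm, zsmul_eq_mul]
      constructor
      · intro h
        rw [h, Real.exp_log hα'.1]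
      · intro h
        rw [h, Real.log_exp]
    have hexp : Real.exp (p * Real.log α') = α' ^ p := by
      rw [Real.rpow_def_of_pos hα'.1, mul_comm]
    rw [← hlog, mem_logScaleSubgroup, Real.exp_log hα'.1, hexp]
    constructor
    · rintro ⟨β', hβ', hmult'⟩ u hu -
      rw [hmult' u hu, eq_rpow_of_apply_mul ha hmono.monotoneOn hφa hα hβ hmult hα' hmult']
    · intro h
      refine ⟨α' ^ p, ⟨Real.rpow_pos_of_pos hα'.1 p,
        Real.rpow_lt_one hα'.1.le hα'.2 hp_pos⟩, fun u hu => h u hu ?_⟩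
      exact ⟨mul_nonneg hα'.1.le hu.1, (mul_le_of_le_one_left hu.1 hα'.2.le).trans hu.2⟩
end
end
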